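/- arXiv:2204.04346 — 4 statements merged into one kernel-verified Lean document; each statement's English description precedes it below -/
import Mathlib

section
/- Let K ⊂ ℝ^d be a connected compact set and let Ω ⊂ ℝ^D be compact. Let H be real analytic in an open neighborhood of K × Ω, and write H_ω(x) = H(x,ω). Suppose there exists no ω ∈ Ω for which H_ω vanishes identically on K. Then there exist τ > 0 and C < ∞ such that for every ω ∈ Ω and every ε > 0, the d-dimensional Lebesgue measure of {x ∈ K : |H_ω(x)| ≤ ε} is at most C·ε^τ. -/
open MeasureTheory Set
open scoped ENNReal
noncomputable section











lemma oneD_aux (g g' : ℝ → ℝ) (I : Set ℝ) (hI : I.OrdConnected)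
    (hd : ∀ t ∈ I, HasDerivAt g (g' t) t) (h1 : ∀ t ∈ I, 1 ≤ g' t) :
    ∀ s ∈ I, ∀ t ∈ I, s ≤ t → t - s ≤ g t - g s := by
  intro s hs t ht hst
  have := Convex.mul_sub_le_image_sub_of_le_deriv (D := I) (f := g) hI.convex
    (fun x hx => (hd x hx).continuousAt.continuousWithinAt)
    (fun x hx => (hd x (interior_subset hx)).differentiableAt.differentiableWithinAt)
    (C := 1) (fun x hx => by
      rw [(hd x (interior_subset hx)).deriv]; exact h1 x (interior_subset hx)) s hs t ht hst
  linarith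

lemma oneD_aux2 (g g' : ℝ → ℝ) (I : Set ℝ) (hI : I.OrdConnected)
    (hd : ∀ t ∈ I, HasDerivAt g (g' t) t) (h1 : ∀ t ∈ I, 1 ≤ g' t) (δ : ℝ) :
    volume {t ∈ I | |g t| ≤ δ} ≤ ENNReal.ofReal (2 * δ) := by
  refine (Real.volume_le_diam _).trans ?_
  refine Metric.ediam_le ?_
  have key := oneD_aux g g' I hI hd h1
  rintro x ⟨hx, hxd⟩ y ⟨hy, hyd⟩
  rw [edist_dist, Real.dist_eq]
  apply ENNReal.ofReal_le_ofReal
  rw [abs_le] at hxd hyd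
  rcases le_total x y with h | h
  · have := key x hx y hy h
    rw [abs_le]; constructor <;> linarith
  · have := key y hy x hx h
    rw [abs_le]; constructor <;> linarith

lemma oneD (k : ℕ) : ∃ A : ℝ, 0 < A ∧ ∀ (F : ℕ → ℝ → ℝ) (I : Set ℝ), I.OrdConnected →
    (∀ j < k + 1, ∀ t ∈ I, HasDerivAt (F j) (F (j + 1) t) t) →
    (∀ t ∈ I, 1 ≤ F (k + 1) t) → ∀ ε : ℝ, 0 < ε →
    volume {t ∈ I | |F 0 t| ≤ ε} ≤ ENNReal.ofReal (A * ε ^ (1 / ((k : ℝ) + 1))) := by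
  induction k with
  | zero =>
    refine ⟨2, by norm_num, fun F I hI hd h1 ε hε => ?_⟩
    have := oneD_aux2 (F 0) (F 1) I hI (hd 0 (by norm_num)) h1 ε
    simpa using this
  | succ k ih =>
    obtain ⟨A, hA, ih⟩ := ih
    refine ⟨2 + A + A, by positivity, fun F I hI hd h1 ε hε => ?_⟩
    set δ : ℝ := ε ^ (1 / (((k + 1 : ℕ) : ℝ) + 1)) with hδ
    have hδ0 : 0 < δ := by positivity
    have hpow : (δ⁻¹ * ε) ^ (1 / ((k : ℝ) + 1)) = δ := by
      have : δ⁻¹ * ε = ε ^ (((k : ℝ) + 1) / ((k : ℝ) + 2)) := by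
        rw [hδ, ← Real.rpow_neg hε.le]
        nth_rewrite 2 [← Real.rpow_one ε]
        rw [← Real.rpow_add hε]
        congr 1
        push_cast
        field_simp
        ring
      rw [this, ← Real.rpow_mul hε.le, hδ]
      congr 1
      push_cast
      field_simp
      ring
    have hg := hd (k + 1) (by omega)
    have key := oneD_aux _ _ I hI hg h1
    have mono : MonotoneOn (F (k + 1)) I := fun s hs t ht hst => by
      have := key s hs t ht hst
      linarith
    have hs : ∀ (σ : ℝ) (J : Set ℝ), (σ = 1 ∨ σ = -1) → J ⊆ I → J.OrdConnected →
        (∀ t ∈ J, δ ≤ σ * F (k + 1) t) →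
        volume {t ∈ J | |F 0 t| ≤ ε} ≤ ENNReal.ofReal (A * δ) := by
      intro σ J hσ hJI hJ hJδ
      have := ih (fun j t => (δ⁻¹ * σ) * F j t) J hJ
        (fun j hj t ht => (hd j (by omega) t (hJI ht)).const_mul _)
        (fun t ht => by
          have := hJδ t ht
          rw [mul_assoc, inv_mul_eq_div, le_div_iff₀ hδ0]; linarith)
        (δ⁻¹ * ε) (by positivity)
      rw [hpow] at this
      refine le_trans (measure_mono ?_) this
      rintro t ⟨ht, h⟩
      refine ⟨ht, ?_⟩
      have hσ1 : |σ| = 1 := by rcases hσ with h | h <;> simp [h]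
      simp only [abs_mul, hσ1, mul_one]
      rw [abs_of_pos (inv_pos.2 hδ0)]
      gcongr
    have hp := hs 1 {t ∈ I | δ ≤ F (k + 1) t} (Or.inl rfl) (fun t h => h.1)
      ⟨fun a ha b hb c hc => ⟨hI.out ha.1 hb.1 hc, ha.2.trans (mono ha.1 (hI.out ha.1 hb.1 hc) hc.1)⟩⟩
      (fun t ht => by simpa using ht.2)
    have hn := hs (-1) {t ∈ I | F (k + 1) t ≤ -δ} (Or.inr rfl) (fun t h => h.1)
      ⟨fun a ha b hb c hc => ⟨hI.out ha.1 hb.1 hc, (mono (hI.out ha.1 hb.1 hc) hb.1 hc.2).trans hb.2⟩⟩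
      (fun t ht => by have := ht.2; linarith)
    have hm := oneD_aux2 _ _ I hI hg h1 δ
    have hsub : {t ∈ I | |F 0 t| ≤ ε} ⊆ {t ∈ I | |F (k + 1) t| ≤ δ} ∪
        {t ∈ {t ∈ I | δ ≤ F (k + 1) t} | |F 0 t| ≤ ε} ∪
        {t ∈ {t ∈ I | F (k + 1) t ≤ -δ} | |F 0 t| ≤ ε} := by
      rintro t ⟨ht, h⟩
      rcases le_total δ (F (k + 1) t) with h1 | h1
      · exact Or.inl (Or.inr ⟨⟨ht, h1⟩, h⟩)
      rcases le_total (F (k + 1) t) (-δ) with h2 | h2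
      · exact Or.inr ⟨⟨ht, h2⟩, h⟩
      · exact Or.inl (Or.inl ⟨ht, abs_le.2 ⟨h2, h1⟩⟩)
    calc _ ≤ _ := measure_mono hsub
      _ ≤ _ := measure_union_le _ _
      _ ≤ _ := add_le_add (measure_union_le _ _) le_rfl
      _ ≤ ENNReal.ofReal (2 * δ) + ENNReal.ofReal (A * δ) + ENNReal.ofReal (A * δ) :=
        add_le_add (add_le_add hm hp) hn
      _ = _ := by
        rw [← ENNReal.ofReal_add (by positivity) (by positivity),
          ← ENNReal.ofReal_add (by positivity) (by positivity)]
        congr 1; ring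

/-- Slicing bound. -/
lemma slice_bound {E : Type*} [NormedAddCommGroup E] [NormedSpace ℝ E] [FiniteDimensional ℝ E]
    [MeasurableSpace E] [BorelSpace E] (μ : Measure E) [μ.IsAddHaarMeasure]
    (v x0 : E) (ρ : ℝ) (S : Set E) (hS : MeasurableSet S) (hSB : S ⊆ Metric.closedBall x0 ρ)
    (m : ℝ≥0∞) (hm : ∀ x, volume {t : ℝ | x + t • v ∈ S} ≤ m) :
    μ S ≤ m * μ (Metric.closedBall x0 (ρ + ‖v‖)) := by
  set f : ℝ → E → ℝ≥0∞ := fun t x => S.indicator 1 (x + t • v) with hf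
  have hfm : Measurable (Function.uncurry f) := by
    have : Measurable (S.indicator (1 : E → ℝ≥0∞)) := measurable_one.indicator hS
    exact this.comp (by fun_prop : Measurable fun p : ℝ × E => p.2 + p.1 • v)
  have h1 : ∀ t, ∫⁻ x, f t x ∂μ = μ S := by
    intro t
    simp only [hf]
    rw [lintegral_add_right_eq_self (fun x => S.indicator (1 : E → ℝ≥0∞) x) (t • v)]
    simp [lintegral_indicator_one hS]
  have h2 : ∫⁻ t in Icc (0 : ℝ) 1, ∫⁻ x, f t x ∂μ = μ S := by
    simp [h1]
  rw [← h2, lintegral_lintegral_swap hfm.aemeasurable]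
  calc _ ≤ ∫⁻ x, (Metric.closedBall x0 (ρ + ‖v‖)).indicator (fun _ => m) x ∂μ := by
        refine lintegral_mono fun x => ?_
        by_cases hx : x ∈ Metric.closedBall x0 (ρ + ‖v‖)
        · rw [indicator_of_mem hx]
          refine le_trans (setLIntegral_le_lintegral _ _) ?_
          refine le_trans (le_of_eq ?_) (hm x)
          rw [← lintegral_indicator_one]
          · rfl
          · exact (by fun_prop : Measurable fun t : ℝ => x + t • v) hS
        · rw [indicator_of_notMem hx]
          refine le_of_eq ?_
          rw [setLIntegral_congr_fun (g := fun _ => 0) measurableSet_Icc, lintegral_zero]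
          intro t ht
          simp only [hf]
          refine indicator_of_notMem (fun h => hx ?_) _
          have h3 := hSB h
          rw [mem_closedBall_iff_norm] at h3 ⊢
          have : x - x0 = (x + t • v - x0) - t • v := by abel
          rw [this]
          refine (norm_sub_le _ _).trans (add_le_add h3 ?_)
          rw [norm_smul, Real.norm_eq_abs, abs_of_nonneg ht.1]
          exact mul_le_of_le_one_left (norm_nonneg _) ht.2
    _ = _ := by
      rw [lintegral_indicator measurableSet_closedBall]; simp

/-- Iterated directional derivatives. -/
def dirD {E : Type*} [NormedAddCommGroup E] [NormedSpace ℝ E] (H : E → ℝ) (w : E) : ℕ → E → ℝ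
  | 0 => H
  | n + 1 => fun p => fderiv ℝ (dirD H w n) p w

lemma dirD_analytic {E : Type*} [NormedAddCommGroup E] [NormedSpace ℝ E] 
    (H : E → ℝ) (w : E) (V : Set E) (hH : AnalyticOnNhd ℝ H V) (n : ℕ) :
    AnalyticOnNhd ℝ (dirD H w n) V := by
  induction n with
  | zero => exact hH
  | succ n ih =>
    intro p hp
    exact ((ContinuousLinearMap.apply ℝ ℝ w).analyticAt _).comp (ih p hp).fderiv

lemma dirD_hasDerivAt {E : Type*} [NormedAddCommGroup E] [NormedSpace ℝ E] 
    (H : E → ℝ) (w : E) (V : Set E) (hH : AnalyticOnNhd ℝ H V) (n : ℕ) (p : E) (t : ℝ)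
    (h : p + t • w ∈ V) :
    HasDerivAt (fun t : ℝ => dirD H w n (p + t • w)) (dirD H w (n + 1) (p + t • w)) t := by
  have h1 := (dirD_analytic H w V hH n _ h).differentiableAt.hasFDerivAt
  have h2 : HasDerivAt (fun t : ℝ => p + t • w) w t := by
    simpa using ((hasDerivAt_id t).smul_const w).const_add p
  exact h1.comp_hasDerivAt t h2

lemma dirD_zero {E : Type*} [NormedAddCommGroup E] [NormedSpace ℝ E]
    (H : E → ℝ) (w : E) (V : Set E) (hV : IsOpen V) (hH : AnalyticOnNhd ℝ H V) (p : E)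
    (hseg : ∀ t ∈ Icc (0 : ℝ) 1, p + t • w ∈ V) (h0 : ∀ n, dirD H w n p = 0) :
    H (p + w) = 0 := by
  set h : ℝ → ℝ := fun t => H (p + t • w) with hh
  have hc : Continuous fun t : ℝ => p + t • w := by fun_prop
  have han : AnalyticOnNhd ℝ h (Icc 0 1) := by
    intro t ht
    refine (hH _ (hseg t ht)).comp_of_eq (f := fun t : ℝ => p + t • w) ?_ rfl
    fun_prop
  have hz : (0 : ℝ) ∈ Icc (0 : ℝ) 1 := by simp
  have hev : ∀ᶠ t in nhds (0 : ℝ), p + t • w ∈ V :=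
    hc.continuousAt.eventually_mem (hV.mem_nhds (hseg 0 hz))
  have hit : ∀ n, iteratedDeriv n h =ᶠ[nhds 0] fun t => dirD H w n (p + t • w) := by
    intro n
    induction n with
    | zero => exact Filter.Eventually.of_forall fun t => by simp [hh, dirD]
    | succ n ih =>
      rw [iteratedDeriv_succ]
      filter_upwards [ih.deriv, hev] with t ht ht2
      rw [ht, (dirD_hasDerivAt H w V hH n p t ht2).deriv]
  have hz0 : h =ᶠ[nhds 0] 0 := by
    have := (han 0 hz).hasFPowerSeriesAt
    have hs : (FormalMultilinearSeries.ofScalars ℝ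
        (fun n => iteratedDeriv n h 0 / (n.factorial : ℝ))) = 0 := by
      ext n
      simp [FormalMultilinearSeries.ofScalars, (hit n).eq_of_nhds, h0]
    rw [hs] at this
    exact this.eventually_eq_zero
  have := han.eqOn_zero_of_preconnected_of_eventuallyEq_zero isPreconnected_Icc hz hz0
    (right_mem_Icc.2 zero_le_one)
  simpa [hh] using this

/-- The local estimate near a point where some iterated directional derivative is nonzero. -/
lemma local_bound {E Y : Type*} [NormedAddCommGroup E] [NormedSpace ℝ E] [FiniteDimensional ℝ E]
    [MeasurableSpace E] [BorelSpace E] (μ : Measure E) [μ.IsAddHaarMeasure]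
    [NormedAddCommGroup Y] [NormedSpace ℝ Y]
    (H : E × Y → ℝ) (V : Set (E × Y)) (hV : IsOpen V) (hH : AnalyticOnNhd ℝ H V)
    (p : E × Y) (hp : p ∈ V) (v : E) (k : ℕ) (hk : dirD H (v, 0) k p ≠ 0) :
    ∃ t ∈ nhds p, ∃ τ C : ℝ, 0 < τ ∧ 0 < C ∧ ∀ ω, ∀ ε : ℝ, 0 < ε → ε ≤ 1 →
      μ {x | (x, ω) ∈ t ∧ |H (x, ω)| ≤ ε} ≤ ENNReal.ofReal (C * ε ^ τ) := by
  set G := dirD H ((v, 0) : E × Y) with hG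
  obtain ⟨s, hs⟩ : ∃ s : ℝ, 1 < s * G k p := ⟨2 / G k p, by rw [div_mul_cancel₀ _ hk]; norm_num⟩
  have hcont : ContinuousAt (fun q => s * G k q) p :=
    (dirD_analytic H (v, 0) V hH k p hp).continuousAt.const_mul s
  have hev : ∀ᶠ q in nhds p, 1 < s * G k q ∧ q ∈ V :=
    (hcont.eventually (lt_mem_nhds hs)).and (hV.mem_nhds hp)
  obtain ⟨ρ, hρ, hball⟩ := Metric.nhds_basis_closedBall.eventually_iff.1 hev
  refine ⟨Metric.closedBall p ρ, Metric.closedBall_mem_nhds p hρ, ?_⟩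
  obtain ⟨x0, ω0⟩ := p
  have hs0 : 0 < |s| := by
    rw [abs_pos]; rintro rfl; norm_num at hs
  rcases k with _ | k
  · -- `|H| > 1/|s|` on the ball
    set B := (μ (Metric.closedBall x0 ρ)).toReal with hB
    refine ⟨1, |s| * B + 1, one_pos, by positivity, fun ω ε hε _ => ?_⟩
    by_cases hc : |s| * ε < 1
    · have : {x | (x, ω) ∈ Metric.closedBall (x0, ω0) ρ ∧ |H (x, ω)| ≤ ε} = ∅ := by
        rw [eq_empty_iff_forall_notMem]
        rintro x ⟨hx, hx2⟩
        have h1 : 1 < s * H (x, ω) := (hball hx).1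
        have h2 := le_abs_self (s * H (x, ω))
        rw [abs_mul] at h2
        nlinarith [mul_le_mul_of_nonneg_left hx2 hs0.le]
      rw [this]; simp
    · have hfin : μ (Metric.closedBall x0 ρ) ≠ ⊤ := measure_closedBall_lt_top.ne
      calc _ ≤ μ (Metric.closedBall x0 ρ) := by
            refine measure_mono fun x hx => ?_
            have := hx.1
            rw [← closedBall_prod_same] at this
            exact this.1
        _ = ENNReal.ofReal B := (ENNReal.ofReal_toReal hfin).symm
        _ ≤ _ := by
          apply ENNReal.ofReal_le_ofReal
          rw [Real.rpow_one]
          push Not at hc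
          have : 0 ≤ B := ENNReal.toReal_nonneg
          nlinarith
  · obtain ⟨A, hA, hone⟩ := oneD k
    set B := (μ (Metric.closedBall x0 (ρ + ‖v‖))).toReal with hB
    have hB0 : 0 ≤ B := ENNReal.toReal_nonneg
    have hfin : μ (Metric.closedBall x0 (ρ + ‖v‖)) ≠ ⊤ := measure_closedBall_lt_top.ne
    refine ⟨1 / ((k : ℝ) + 1), A * |s| ^ (1 / ((k : ℝ) + 1)) * B + 1, by positivity, by positivity,
      fun ω ε hε _ => ?_⟩
    set S := {x | (x, ω) ∈ Metric.closedBall (x0, ω0) ρ ∧ |H (x, ω)| ≤ ε} with hS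
    have hclosed : IsClosed S := by
      have hT : IsClosed {x : E | (x, ω) ∈ Metric.closedBall (x0, ω0) ρ} :=
        Metric.isClosed_closedBall.preimage (by fun_prop : Continuous fun x : E => (x, ω))
      have hcO : ContinuousOn (fun x => |H (x, ω)|)
          {x : E | (x, ω) ∈ Metric.closedBall (x0, ω0) ρ} := by
        intro x hx
        have h1 : ContinuousAt H (x, ω) := (hH _ (hball hx).2).continuousAt
        have h2 : ContinuousAt (fun x : E => H (x, ω)) x :=
          ContinuousAt.comp (f := fun x : E => (x, ω)) h1 (by fun_prop)
        exact h2.abs.continuousWithinAt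
      exact hcO.preimage_isClosed_of_isClosed hT (isClosed_Iic (a := ε))
    have hSB : S ⊆ Metric.closedBall x0 ρ := by
      intro x hx
      have := hx.1
      rw [← closedBall_prod_same] at this
      exact this.1
    have hcurve : ∀ (x : E) (t : ℝ), ((x, ω) : E × Y) + t • ((v, 0) : E × Y) = (x + t • v, ω) := by
      intro x t; simp
    have hm : ∀ x, volume {t : ℝ | x + t • v ∈ S} ≤
        ENNReal.ofReal (A * (|s| * ε) ^ (1 / ((k : ℝ) + 1))) := by
      intro x
      have hord : {t : ℝ | (x + t • v, ω) ∈ Metric.closedBall (x0, ω0) ρ}.OrdConnected := by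
        have h1 := (convex_closedBall ((x0, ω0) : E × Y) ρ).affine_preimage
          (AffineMap.lineMap ((x, ω) : E × Y) ((x, ω) + (v, 0) : E × Y) : ℝ →ᵃ[ℝ] E × Y)
        have h2 := h1.ordConnected
        have h3 : {t : ℝ | (x + t • v, ω) ∈ Metric.closedBall (x0, ω0) ρ} =
            (AffineMap.lineMap ((x, ω) : E × Y) ((x, ω) + (v, 0) : E × Y) : ℝ →ᵃ[ℝ] E × Y) ⁻¹'
              Metric.closedBall (x0, ω0) ρ := by
          ext t
          rw [mem_preimage, mem_setOf_eq, AffineMap.lineMap_apply]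
          simp [add_comm]
        rw [h3]
        exact h2
      have := hone (fun j t => s * G j ((x, ω) + t • ((v, 0) : E × Y))) _ hord
        (fun j _ t ht => (dirD_hasDerivAt H (v, 0) V hH j (x, ω) t
          (by rw [hcurve]; exact (hball ht).2)).const_mul s)
        (fun t ht => by
          rw [hcurve]; exact (hball ht).1.le) (|s| * ε) (by positivity)
      refine le_trans (measure_mono ?_) this
      rintro t ⟨ht, ht2⟩
      refine ⟨ht, ?_⟩
      simp only [hcurve, abs_mul]
      exact mul_le_mul_of_nonneg_left ht2 hs0.le
    refine (slice_bound μ v x0 ρ S hclosed.measurableSet hSB _ hm).trans ?_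
    rw [← ENNReal.ofReal_toReal hfin, ← hB, ← ENNReal.ofReal_mul (by positivity)]
    apply ENNReal.ofReal_le_ofReal
    rw [Real.mul_rpow hs0.le hε.le]
    have : 0 < ε ^ (1 / ((k : ℝ) + 1)) := by positivity
    nlinarith

/-- Some iterated directional derivative is nonzero at each point. -/
lemma exists_dirD_ne {E Y : Type*} [NormedAddCommGroup E] [NormedSpace ℝ E]
    [NormedAddCommGroup Y] [NormedSpace ℝ Y]
    (H : E × Y → ℝ) (V : Set (E × Y)) (hV : IsOpen V) (hH : AnalyticOnNhd ℝ H V)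
    (K : Set E) (hK : IsPreconnected K) (ω : Y) (hKV : ∀ x ∈ K, (x, ω) ∈ V)
    (hne : ∃ x ∈ K, H (x, ω) ≠ 0) (x0 : E) (hx0 : x0 ∈ K) :
    ∃ v : E, ∃ k, dirD H (v, 0) k (x0, ω) ≠ 0 := by
  by_contra! hcon
  obtain ⟨x, hx, hxne⟩ := hne
  have han : AnalyticOnNhd ℝ (fun x => H (x, ω)) K := by
    intro x hx
    refine (hH _ (hKV x hx)).comp_of_eq (f := fun x : E => (x, ω)) ?_ rfl
    fun_prop
  have hc : Continuous fun x : E => (x, ω) := by fun_prop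
  obtain ⟨r, hr, hball⟩ := Metric.mem_nhds_iff.1
    ((hV.preimage hc).mem_nhds (hKV x0 hx0))
  have hz : (fun x => H (x, ω)) =ᶠ[nhds x0] 0 := by
    filter_upwards [Metric.ball_mem_nhds x0 hr] with y hy
    have := dirD_zero H (y - x0, 0) V hV hH (x0, ω) (fun t ht => by
      have : x0 + t • (y - x0) ∈ Metric.ball x0 r :=
        (convex_ball x0 r).add_smul_sub_mem (Metric.mem_ball_self hr) hy ht
      have := hball this
      simpa using this) (hcon _)
    simpa using this
  exact hxne (han.eqOn_zero_of_preconnected_of_eventuallyEq_zero hK hx0 hz hx)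

/-- Lemma 4.1: uniform sublevel set bound for a compact family of real analytic functions,
none of which vanishes identically on the connected compact set `K`. -/
theorem analytic_family_sublevel_bound
    (d D : ℕ) (hd : 0 < d) (hD : 0 < D)
    (K : Set (EuclideanSpace ℝ (Fin d))) (Ω : Set (EuclideanSpace ℝ (Fin D)))
    (hKcompact : IsCompact K) (hKconn : IsConnected K) (hΩcompact : IsCompact Ω)
    (H : EuclideanSpace ℝ (Fin d) × EuclideanSpace ℝ (Fin D) → ℝ)
    (V : Set (EuclideanSpace ℝ (Fin d) × EuclideanSpace ℝ (Fin D)))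
    (hV : IsOpen V) (hKΩV : K ×ˢ Ω ⊆ V)
    (hH : AnalyticOnNhd ℝ H V)
    (hnv : ∀ ω ∈ Ω, ∃ x ∈ K, H (x, ω) ≠ 0) :
    ∃ τ C : ℝ, 0 < τ ∧ 0 < C ∧ ∀ ω ∈ Ω, ∀ ε : ℝ, 0 < ε →
      volume {x ∈ K | |H (x, ω)| ≤ ε} ≤ ENNReal.ofReal (C * ε ^ τ) := by
  have main : ∃ τ C : ℝ, 0 < τ ∧ 0 < C ∧ ∀ ω, ∀ ε : ℝ, 0 < ε → ε ≤ 1 →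
      volume {x | (x, ω) ∈ K ×ˢ Ω ∧ |H (x, ω)| ≤ ε} ≤ ENNReal.ofReal (C * ε ^ τ) := by
    refine (hKcompact.prod hΩcompact).induction_on
      (p := fun t => ∃ τ C : ℝ, 0 < τ ∧ 0 < C ∧ ∀ ω, ∀ ε : ℝ, 0 < ε → ε ≤ 1 →
      volume {x | (x, ω) ∈ t ∧ |H (x, ω)| ≤ ε} ≤ ENNReal.ofReal (C * ε ^ τ)) ?_ ?_ ?_ ?_
    · exact ⟨1, 1, one_pos, one_pos, fun ω ε _ _ => by simp⟩
    · rintro s t hst ⟨τ, C, hτ, hC, h⟩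
      exact ⟨τ, C, hτ, hC, fun ω ε h1 h2 =>
        le_trans (measure_mono fun x hx => And.intro (hst hx.1) hx.2) (h ω ε h1 h2)⟩
    · rintro s t ⟨τ, C, hτ, hC, h⟩ ⟨τ', C', hτ', hC', h'⟩
      refine ⟨min τ τ', C + C', lt_min hτ hτ', by positivity, fun ω ε h1 h2 => ?_⟩
      have hsub : {x | (x, ω) ∈ s ∪ t ∧ |H (x, ω)| ≤ ε} ⊆
          {x | (x, ω) ∈ s ∧ |H (x, ω)| ≤ ε} ∪ {x | (x, ω) ∈ t ∧ |H (x, ω)| ≤ ε} := by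
        rintro x ⟨hx | hx, hx2⟩
        · exact Or.inl ⟨hx, hx2⟩
        · exact Or.inr ⟨hx, hx2⟩
      refine (measure_mono hsub).trans ((measure_union_le _ _).trans
        ((add_le_add (h ω ε h1 h2) (h' ω ε h1 h2)).trans ?_))
      rw [← ENNReal.ofReal_add (by positivity) (by positivity), add_mul]
      apply ENNReal.ofReal_le_ofReal
      have e1 := Real.rpow_le_rpow_of_exponent_ge h1 h2 (min_le_left τ τ')
      have e2 := Real.rpow_le_rpow_of_exponent_ge h1 h2 (min_le_right τ τ')
      gcongr
    · rintro ⟨x0, ω0⟩ ⟨hx0, hω0⟩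
      obtain ⟨v, k, hk⟩ := exists_dirD_ne H V hV hH K hKconn.isPreconnected ω0
        (fun x hx => hKΩV ⟨hx, hω0⟩) (hnv ω0 hω0) x0 hx0
      obtain ⟨t, ht, h⟩ := local_bound volume H V hV hH (x0, ω0) (hKΩV ⟨hx0, hω0⟩) v k hk
      exact ⟨t, mem_nhdsWithin_of_mem_nhds ht, h⟩
  obtain ⟨τ, C, hτ, hC, h⟩ := main
  have hfin : volume K ≠ ⊤ := hKcompact.measure_lt_top.ne
  have hM : 0 ≤ (volume K).toReal := ENNReal.toReal_nonneg
  refine ⟨τ, C + (volume K).toReal, hτ, by positivity, fun ω hω ε hε => ?_⟩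
  rcases le_total ε 1 with h1 | h1
  · refine (measure_mono fun x hx => ?_).trans ((h ω ε hε h1).trans ?_)
    · exact ⟨⟨hx.1, hω⟩, hx.2⟩
    · apply ENNReal.ofReal_le_ofReal
      gcongr
      linarith
  · refine (measure_mono fun x hx => hx.1).trans ?_
    rw [← ENNReal.ofReal_toReal hfin]
    apply ENNReal.ofReal_le_ofReal
    rw [ENNReal.toReal_ofReal hM]
    have := Real.one_le_rpow h1 hτ.le
    nlinarith
end
end

section
/- Let D, N ∈ ℕ and let B be a closed ball in ℝ^D of positive, finite radius. There exist constants c, C ∈ (0,∞), depending only on D, N and B, with the following property. Let F be a real-valued C^{N+1} function defined on an open neighborhood of B with Σ_{|α| ≤ N+1} sup_{x ∈ B} |∂^α F(x)| ≤ 1. Let δ > 0 and suppose that for each x ∈ B, Σ_{0 ≤ |α| ≤ N} |∂^α F(x)| ≥ δ. Then for every η > 0, the Lebesgue measure of {x ∈ B : |F(x)| ≤ η} is at most C·η^c·δ^{−C}. -/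
open MeasureTheory Set
open scoped ENNReal

noncomputable section

/-- Local-to-global: averaging over small balls. -/
theorem local_to_global {D : ℕ} (S : Set (EuclideanSpace ℝ (Fin D))) (hS : MeasurableSet S)
    (x₀ : EuclideanSpace ℝ (Fin D)) (r ρ : ℝ) (hρ : 0 < ρ) (hSB : S ⊆ Metric.closedBall x₀ r)
    (κ : ℝ≥0∞)
    (hloc : ∀ y, volume (S ∩ Metric.ball y ρ)
      ≤ κ * volume (Metric.ball (0 : EuclideanSpace ℝ (Fin D)) ρ)) :
    volume S ≤ κ * volume (Metric.ball x₀ (r + ρ)) := by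
  set v0 := volume (Metric.ball (0 : EuclideanSpace ℝ (Fin D)) ρ) with hv0
  have hv0pos : v0 ≠ 0 := (Metric.measure_ball_pos volume _ hρ).ne'
  have hv0fin : v0 ≠ ⊤ := measure_ball_lt_top.ne
  let P : Set (EuclideanSpace ℝ (Fin D) × EuclideanSpace ℝ (Fin D)) :=
    {p | p.1 ∈ S ∧ dist p.1 p.2 < ρ}
  have hP : MeasurableSet P := by
    apply MeasurableSet.inter
    · exact measurable_fst hS
    · exact (isOpen_lt (continuous_fst.dist continuous_snd) continuous_const).measurableSet
  have h1 : (volume.prod volume) P = volume S * v0 := by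
    rw [Measure.prod_apply hP]
    have : ∀ x, volume (Prod.mk x ⁻¹' P) = S.indicator (fun _ => v0) x := by
      intro x
      by_cases hx : x ∈ S
      · have : Prod.mk x ⁻¹' P = Metric.ball x ρ := by
          ext y; simp [P, hx, dist_comm]
        rw [this, Set.indicator_of_mem hx, hv0]
        exact Measure.addHaar_ball_center volume x ρ
      · have : Prod.mk x ⁻¹' P = ∅ := by
          ext y; simp [P, hx]
        rw [this, Set.indicator_of_notMem hx]; simp
    simp_rw [this]
    rw [lintegral_indicator hS, lintegral_const, Measure.restrict_apply_univ, mul_comm]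
  have h2 : (volume.prod volume) P ≤ κ * v0 * volume (Metric.ball x₀ (r + ρ)) := by
    rw [Measure.prod_apply_symm hP]
    have : ∀ y, volume ((fun x => (x, y)) ⁻¹' P)
        ≤ (Metric.ball x₀ (r + ρ)).indicator (fun _ => κ * v0) y := by
      intro y
      have e : (fun x => (x, y)) ⁻¹' P = S ∩ Metric.ball y ρ := by
        ext x; simp [P]
      rw [e]
      by_cases hy : y ∈ Metric.ball x₀ (r + ρ)
      · rw [Set.indicator_of_mem hy]; exact hloc y
      · have : S ∩ Metric.ball y ρ = ∅ := by
          ext x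
          simp only [mem_inter_iff, mem_empty_iff_false, iff_false, not_and]
          intro hx hxy
          apply hy
          have a1 := hSB hx
          rw [Metric.mem_closedBall] at a1
          rw [Metric.mem_ball] at hxy ⊢
          have := dist_triangle y x x₀
          rw [dist_comm y x] at this
          linarith
        rw [this]; simp
    refine (lintegral_mono this).trans ?_
    rw [lintegral_indicator Metric.isOpen_ball.measurableSet, lintegral_const,
      Measure.restrict_apply_univ]
  rw [h1] at h2
  have h3 : volume S * v0 ≤ (κ * volume (Metric.ball x₀ (r + ρ))) * v0 := by
    calc _ ≤ _ := h2
      _ = _ := by ring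
  exact (ENNReal.mul_le_mul_iff_left hv0pos hv0fin).1 h3

/-- Local estimate by packing disjoint translates. -/
theorem local_bound_s2 {D : ℕ} {W : Type*} [NormedAddCommGroup W] [NormedSpace ℝ W]
    (H : EuclideanSpace ℝ (Fin D) → W) (B S : Set (EuclideanSpace ℝ (Fin D)))
    (hB : Convex ℝ B) (hd : ∀ x ∈ B, DifferentiableAt ℝ H x)
    (hL : ∀ x ∈ B, ∀ y ∈ B, ‖fderiv ℝ H x - fderiv ℝ H y‖ ≤ ‖x - y‖)
    (hSB : S ⊆ B) (hS : MeasurableSet S) (a b : ℝ) (ha : 0 < a) (hb : 0 < b)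
    (hSa : ∀ x ∈ S, ‖H x‖ ≤ a) (hSb : ∀ x ∈ S, b ≤ ‖fderiv ℝ H x‖)
    (y : EuclideanSpace ℝ (Fin D)) :
    volume (S ∩ Metric.ball y (b / 8)) ≤
      ENNReal.ofReal (144 * a / b ^ 2 * 2 ^ D) *
        volume (Metric.ball (0 : EuclideanSpace ℝ (Fin D)) (b / 8)) := by
  have hball : volume (Metric.ball y (2 * (b / 8)))
      = ENNReal.ofReal (2 ^ D) *
        volume (Metric.ball (0 : EuclideanSpace ℝ (Fin D)) (b / 8)) := by
    rw [Measure.addHaar_ball_mul_of_pos volume y (by norm_num : (0:ℝ) < 2)]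
    simp
  rw [ENNReal.ofReal_mul (by positivity), mul_assoc, ← hball]
  set Q := volume (Metric.ball y (2 * (b / 8))) with hQ
  set S' := S ∩ Metric.ball y (b / 8) with hS'
  have hS'Q : S' ⊆ Metric.ball y (2 * (b / 8)) :=
    inter_subset_right.trans (Metric.ball_subset_ball (by linarith))
  by_cases hab : b ^ 2 < 72 * a
  · calc volume S' ≤ Q := measure_mono hS'Q
      _ = 1 * Q := by rw [one_mul]
      _ ≤ _ := by
        gcongr
        rw [ENNReal.one_le_ofReal, le_div_iff₀ (by positivity)]
        linarith
  push Not at hab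
  rcases S'.eq_empty_or_nonempty with he | ⟨z, hzS, hzy⟩
  · rw [he]; simp
  have hz := hSb z hzS
  obtain ⟨v, hv1, hv2⟩ := (fderiv ℝ H z).exists_lt_apply_of_lt_opNorm
    (show b / 2 < ‖fderiv ℝ H z‖ by linarith)
  -- key separation estimate
  have key : ∀ x ∈ S', ∀ t : ℝ, x + t • v ∈ S' → |t| ≤ 8 * a / b := by
    intro x hx t hxt
    have hconv : Convex ℝ (B ∩ Metric.ball y (b / 8)) := hB.inter (convex_ball _ _)
    have h1 := hconv.norm_image_sub_le_of_norm_fderiv_le' (𝕜 := ℝ) (f := H)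
      (φ := fderiv ℝ H z) (C := b / 4) (x := x) (y := x + t • v)
      (fun w hw => hd w hw.1)
      (fun w hw => by
        refine (hL w hw.1 z (hSB hzS)).trans ?_
        rw [← dist_eq_norm]
        have := dist_triangle_right w z y
        have h1 := hw.2
        rw [Metric.mem_ball] at h1 hzy
        linarith) ⟨hSB hx.1, hx.2⟩ ⟨hSB hxt.1, hxt.2⟩
    rw [add_sub_cancel_left, map_smul] at h1
    have h2 : ‖t • (fderiv ℝ H z) v‖ ≤ ‖H (x + t • v) - H x‖
        + ‖H (x + t • v) - H x - t • (fderiv ℝ H z) v‖ := by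
      have := norm_sub_le (H (x + t • v) - H x) (H (x + t • v) - H x - t • (fderiv ℝ H z) v)
      simpa using this
    have h3 := norm_sub_le (H (x + t • v)) (H x)
    have h4 := hSa _ hxt.1
    have h5 := hSa _ hx.1
    rw [norm_smul] at h2 h1
    rw [Real.norm_eq_abs] at h1 h2
    have ht := abs_nonneg t
    have h6 : |t| * ‖v‖ ≤ |t| := by nlinarith
    have h7 : |t| * (b / 2) ≤ |t| * ‖(fderiv ℝ H z) v‖ := by gcongr
    rw [le_div_iff₀ hb]
    nlinarith
  set τ := 9 * a / b with hτ
  have hτ0 : 0 < τ := by positivity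
  set M := ⌊b ^ 2 / (72 * a)⌋₊ with hM
  have hM1 : (M : ℝ) ≤ b ^ 2 / (72 * a) := Nat.floor_le (by positivity)
  have hq : 1 ≤ b ^ 2 / (72 * a) := by rw [le_div_iff₀ (by positivity)]; linarith
  have hM2 : b ^ 2 / (144 * a) ≤ M := by
    have h1 := Nat.lt_floor_add_one (b ^ 2 / (72 * a))
    have h2 : (1:ℝ) ≤ M := by exact_mod_cast (Nat.one_le_floor_iff _).2 hq
    have h3 : b ^ 2 / (144 * a) = b ^ 2 / (72 * a) / 2 := by field_simp; norm_num
    rw [h3]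
    rw [← hM] at h1
    linarith
  have hMτ : M * τ ≤ b / 8 := by
    calc M * τ ≤ b ^ 2 / (72 * a) * τ := by gcongr
      _ = b / 8 := by rw [hτ]; field_simp; norm_num
  let T : ℕ → Set (EuclideanSpace ℝ (Fin D)) := fun j => (fun x => x + (j * τ) • v) ⁻¹' S'
  have hS'm : MeasurableSet S' := hS.inter Metric.isOpen_ball.measurableSet
  have hTm : ∀ j, MeasurableSet (T j) := fun j =>
    (by fun_prop : Measurable (fun x : EuclideanSpace ℝ (Fin D) => x + ((j:ℝ) * τ) • v)) hS'm
  have hTv : ∀ j, volume (T j) = volume S' := fun j => measure_preimage_add_right _ _ _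
  have hTd : (↑(Finset.range M) : Set ℕ).PairwiseDisjoint T := by
    intro i _ j _ hij
    rw [Function.onFun, Set.disjoint_left]
    intro x hi hj
    have := key (x + (i * τ) • v) hi ((j - i) * τ) (by
      have e : x + (i * τ) • v + ((↑j - ↑i) * τ) • v = x + (j * τ) • v := by module
      rw [e]; exact hj)
    rw [abs_mul, abs_of_pos hτ0] at this
    have h1 : (1:ℝ) ≤ |(j:ℝ) - i| := by
      have : (1:ℤ) ≤ |(j:ℤ) - i| := Int.one_le_abs (by omega)
      exact_mod_cast this
    have h2 : 8 * a / b < τ := by rw [hτ]; gcongr; norm_num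
    nlinarith
  have hTQ : ⋃ j ∈ Finset.range M, T j ⊆ Metric.ball y (2 * (b / 8)) := by
    intro x hx
    simp only [mem_iUnion, Finset.mem_range] at hx
    obtain ⟨j, hj, hx⟩ := hx
    have h1 : dist (x + (j * τ) • v) y < b / 8 := hx.2
    rw [Metric.mem_ball]
    have h2 := dist_triangle x (x + (j * τ) • v) y
    have h3 : dist x (x + (j * τ) • v) ≤ b / 8 := by
      rw [dist_self_add_right, norm_smul, Real.norm_of_nonneg (by positivity)]
      have : (j:ℝ) * τ ≤ M * τ := by gcongr
      have h0 : 0 ≤ (j:ℝ) * τ := by positivity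
      nlinarith
    linarith
  have hsum : (M : ℝ≥0∞) * volume S' ≤ Q := by
    calc (M : ℝ≥0∞) * volume S' = ∑ j ∈ Finset.range M, volume (T j) := by
          simp [hTv]
      _ = volume (⋃ j ∈ Finset.range M, T j) :=
          (measure_biUnion_finset hTd (fun j _ => hTm j)).symm
      _ ≤ Q := measure_mono hTQ
  calc volume S' = 1 * volume S' := by rw [one_mul]
    _ ≤ (ENNReal.ofReal (144 * a / b ^ 2) * M) * volume S' := by
        gcongr
        rw [← ENNReal.ofReal_natCast, ← ENNReal.ofReal_mul (by positivity), ENNReal.one_le_ofReal]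
        calc (1:ℝ) = 144 * a / b ^ 2 * (b ^ 2 / (144 * a)) := by field_simp
          _ ≤ _ := by gcongr
    _ = ENNReal.ofReal (144 * a / b ^ 2) * (M * volume S') := by rw [mul_assoc]
    _ ≤ _ := by gcongr

/-- Lemma 4.2: quantitative sublevel set bound for a `C^{N+1}` function, bounded in
`C^{N+1}` norm by 1, whose derivatives of order at most `N` have sum of absolute values
at least `δ` at every point of the ball `B`. -/
theorem quantitative_sublevel_bound
    (D N : ℕ) (x₀ : EuclideanSpace ℝ (Fin D)) (r : ℝ) (hr : 0 < r) :
    ∃ c C : ℝ, 0 < c ∧ 0 < C ∧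
      ∀ (F : EuclideanSpace ℝ (Fin D) → ℝ) (V : Set (EuclideanSpace ℝ (Fin D))),
        IsOpen V → Metric.closedBall x₀ r ⊆ V → ContDiffOn ℝ (N + 1) F V →
        (∑ k ∈ Finset.range (N + 2),
          ⨆ x ∈ Metric.closedBall x₀ r, ‖iteratedFDeriv ℝ k F x‖) ≤ 1 →
        ∀ δ : ℝ, 0 < δ →
        (∀ x ∈ Metric.closedBall x₀ r,
          δ ≤ ∑ k ∈ Finset.range (N + 1), ‖iteratedFDeriv ℝ k F x‖) →
        ∀ η : ℝ, 0 < η →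
          volume {x ∈ Metric.closedBall x₀ r | |F x| ≤ η} ≤
            ENNReal.ofReal (C * η ^ c * δ ^ (-C)) := by
  set vol : ℝ := (volume (Metric.ball x₀ (r + 1))).toReal with hvol
  have hvolfin : volume (Metric.ball x₀ (r + 1)) ≠ ⊤ := measure_ball_lt_top.ne
  have hvol0 : 0 ≤ vol := ENNReal.toReal_nonneg
  have hvole : volume (Metric.ball x₀ (r + 1)) = ENNReal.ofReal vol :=
    (ENNReal.ofReal_toReal hvolfin).symm
  set K : ℝ := 144 * 2 ^ D * vol with hK
  have hK0 : 0 ≤ K := by positivity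
  have hvolK : vol ≤ K := by
    rw [hK]
    have : (1:ℝ) ≤ 2 ^ D := one_le_pow₀ (by norm_num)
    nlinarith
  set C : ℝ := max ((N + 1) * K) 1 with hC
  have hC1 : 1 ≤ C := le_max_right _ _
  refine ⟨((3:ℝ) ^ N)⁻¹, C, by positivity, by linarith, ?_⟩
  intro F V hV hBV hF hsup δ hδ hlow η hη
  set B := Metric.closedBall x₀ r with hB
  have hBconv : Convex ℝ B := convex_closedBall _ _
  have hBcomp : IsCompact B := isCompact_closedBall _ _
  -- regularity
  have hFat : ∀ x ∈ B, ContDiffAt ℝ (N + 1) F x := fun x hx =>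
    hF.contDiffAt (hV.mem_nhds (hBV hx))
  have hdiff : ∀ k ≤ N, ∀ x ∈ B, DifferentiableAt ℝ (iteratedFDeriv ℝ k F) x := by
    intro k hk x hx
    exact (hFat x hx).differentiableAt_iteratedFDeriv (by exact_mod_cast Nat.lt_succ_of_le hk)
  have hcont : ∀ k ≤ N + 1, ContinuousOn (iteratedFDeriv ℝ k F) B := by
    intro k hk
    have h1 := hF.continuousOn_iteratedFDerivWithin (m := k) (by exact_mod_cast hk)
      hV.uniqueDiffOn
    exact (h1.congr (fun x hx => (iteratedFDerivWithin_of_isOpen k hV hx).symm)).mono hBV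
  -- pointwise bounds
  have hbdd : ∀ k ≤ N + 1, ∀ x ∈ B, ‖iteratedFDeriv ℝ k F x‖
      ≤ ⨆ x ∈ B, ‖iteratedFDeriv ℝ k F x‖ := by
    intro k hk x hx
    obtain ⟨R, hR⟩ := hBcomp.exists_bound_of_continuousOn (hcont k hk)
    have hbd : BddAbove (range fun x => ⨆ (_ : x ∈ B), ‖iteratedFDeriv ℝ k F x‖) := by
      refine ⟨max R 0, ?_⟩
      rintro _ ⟨w, rfl⟩
      exact Real.iSup_le (fun hw => (hR w hw).trans (le_max_left _ _)) (le_max_right _ _)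
    refine le_trans ?_ (le_ciSup hbd x)
    simp [hx]
  have hsup0 : ∀ k, 0 ≤ ⨆ x ∈ B, ‖iteratedFDeriv ℝ k F x‖ := fun k =>
    Real.iSup_nonneg fun x => Real.iSup_nonneg fun _ => norm_nonneg _
  have hle1 : ∀ k ≤ N + 1, ∀ x ∈ B, ‖iteratedFDeriv ℝ k F x‖ ≤ 1 := by
    intro k hk x hx
    refine (hbdd k hk x hx).trans (le_trans ?_ hsup)
    exact Finset.single_le_sum (f := fun k => ⨆ x ∈ B, ‖iteratedFDeriv ℝ k F x‖)
      (fun i _ => hsup0 i) (Finset.mem_range.2 (by omega))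
  have hx₀ : x₀ ∈ B := Metric.mem_closedBall_self hr.le
  have hδ1 : δ ≤ 1 := by
    refine (hlow x₀ hx₀).trans (le_trans ?_ hsup)
    rw [Finset.sum_range_succ _ (N + 1)]
    refine le_trans (Finset.sum_le_sum fun k hk => hbdd k ?_ x₀ hx₀) ?_
    · have := Finset.mem_range.1 hk; omega
    · linarith [hsup0 (N + 1)]
  set θ : ℝ := η ^ ((3:ℝ) ^ N)⁻¹ with hθ
  have hθ0 : 0 < θ := Real.rpow_pos_of_pos hη _
  have hθη : θ ^ (3 ^ N) = η := by
    rw [hθ, ← Real.rpow_natCast, ← Real.rpow_mul hη.le]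
    push_cast
    rw [inv_mul_cancel₀ (by positivity), Real.rpow_one]
  -- reduction
  suffices hmain : volume {x ∈ B | |F x| ≤ η} ≤ ENNReal.ofReal ((N + 1) * K * θ * δ⁻¹) by
    refine hmain.trans (ENNReal.ofReal_le_ofReal ?_)
    have h1 : δ⁻¹ ≤ δ ^ (-C) := by
      rw [← Real.rpow_neg_one]
      exact Real.rpow_le_rpow_of_exponent_ge hδ hδ1 (by linarith)
    have h2 : (N + 1) * K ≤ C := le_max_left _ _
    gcongr
  have hδi : 1 ≤ δ⁻¹ := (one_le_inv₀ hδ).2 hδ1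
  by_cases hcase : δ ≤ (N + 1) * θ
  · calc volume {x ∈ B | |F x| ≤ η} ≤ volume (Metric.ball x₀ (r + 1)) :=
          measure_mono ((sep_subset _ _).trans (Metric.closedBall_subset_ball (by linarith)))
      _ = ENNReal.ofReal vol := hvole
      _ ≤ _ := by
        apply ENNReal.ofReal_le_ofReal
        have : 1 ≤ (N + 1) * θ * δ⁻¹ := by
          rw [← div_eq_mul_inv, le_div_iff₀ hδ]; linarith
        calc vol ≤ K := hvolK
          _ ≤ K * ((N + 1) * θ * δ⁻¹) := le_mul_of_one_le_right hK0 this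
          _ = _ := by ring
  push Not at hcase
  have hθ1 : θ ≤ 1 := by
    have : (0:ℝ) ≤ N * θ := by positivity
    nlinarith
  set e : ℕ → ℝ := fun k => θ ^ (3 ^ (N - k)) with he
  have he0 : ∀ k, 0 < e k := fun k => pow_pos hθ0 _
  have heθ : ∀ k, e k ≤ θ := fun k =>
    pow_le_of_le_one hθ0.le hθ1 (by positivity)
  have hestep : ∀ k < N, e k = e (k + 1) ^ 3 := by
    intro k hk
    simp only [he]
    rw [← pow_mul, ← pow_succ]
    congr 2
    omega
  let S : ℕ → Set (EuclideanSpace ℝ (Fin D)) := fun k =>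
    {x ∈ B | ‖iteratedFDeriv ℝ k F x‖ ≤ e k ∧ e (k + 1) ≤ ‖iteratedFDeriv ℝ (k + 1) F x‖}
  have hcover : {x ∈ B | |F x| ≤ η} ⊆ ⋃ k ∈ Finset.range N, S k := by
    rintro x ⟨hx, hFx⟩
    by_contra hno
    simp only [mem_iUnion, Finset.mem_range, not_exists] at hno
    have hind : ∀ k ≤ N, ‖iteratedFDeriv ℝ k F x‖ ≤ e k := by
      intro k
      induction k with
      | zero => intro _; simpa [he, hθη] using hFx
      | succ k ih =>
        intro hk
        by_contra hlt
        push Not at hlt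
        exact hno k (by omega) ⟨hx, ih (by omega), hlt.le⟩
    have h1 := hlow x hx
    have h2 : ∑ k ∈ Finset.range (N + 1), ‖iteratedFDeriv ℝ k F x‖
        ≤ ∑ k ∈ Finset.range (N + 1), θ :=
      Finset.sum_le_sum fun k hk =>
        (hind k (by have := Finset.mem_range.1 hk; omega)).trans (heθ k)
    simp at h2
    linarith
  have hSk : ∀ k ∈ Finset.range N, volume (S k) ≤ ENNReal.ofReal (K * θ) := by
    intro k hk
    have hk := Finset.mem_range.1 hk
    have hSm : MeasurableSet (S k) := by
      have hBc : IsClosed B := Metric.isClosed_closedBall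
      have c1 := (hcont k (by omega)).norm.preimage_isClosed_of_isClosed hBc
        (isClosed_Iic (a := e k))
      have c2 := (hcont (k + 1) (by omega)).norm.preimage_isClosed_of_isClosed hBc
        (isClosed_Ici (a := e (k + 1)))
      have : S k = (B ∩ (fun x => ‖iteratedFDeriv ℝ k F x‖) ⁻¹' Iic (e k)) ∩
          (B ∩ (fun x => ‖iteratedFDeriv ℝ (k + 1) F x‖) ⁻¹' Ici (e (k + 1))) := by
        ext x
        simp only [S, mem_ofPred_eq, mem_inter_iff, mem_preimage, mem_Iic, mem_Ici]
        tauto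
      rw [this]
      exact (c1.inter c2).measurableSet
    have hSB : S k ⊆ B := sep_subset _ _
    have hLip : ∀ x ∈ B, ∀ y ∈ B, ‖fderiv ℝ (iteratedFDeriv ℝ k F) x
        - fderiv ℝ (iteratedFDeriv ℝ k F) y‖ ≤ ‖x - y‖ := by
      intro x hx y hy
      have h1 := hBconv.norm_image_sub_le_of_norm_fderiv_le (𝕜 := ℝ)
        (f := iteratedFDeriv ℝ (k + 1) F) (C := 1) (x := y) (y := x)
        (hdiff (k + 1) (by omega))
        (fun w hw => by
          rw [norm_fderiv_iteratedFDeriv]; exact hle1 (k + 2) (by omega) w hw) hy hx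
      rw [one_mul] at h1
      refine le_trans (le_of_eq ?_) h1
      rw [iteratedFDeriv_succ_eq_comp_left, Function.comp_apply, Function.comp_apply,
        ← dist_eq_norm]
      exact (dist_eq_norm (fderiv ℝ (iteratedFDeriv ℝ k F) x)
        (fderiv ℝ (iteratedFDeriv ℝ k F) y)).symm.trans
        (LinearIsometryEquiv.dist_map _ _ _).symm
    have hloc := local_bound_s2 (iteratedFDeriv ℝ k F) B (S k) hBconv (hdiff k (by omega)) hLip
      hSB hSm (e k) (e (k + 1)) (he0 _) (he0 _) (fun x hx => hx.2.1)
      (fun x hx => by rw [norm_fderiv_iteratedFDeriv]; exact hx.2.2)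
    have hglob := local_to_global (S k) hSm x₀ r (e (k + 1) / 8)
      (by have := he0 (k + 1); positivity) hSB _ hloc
    refine hglob.trans ?_
    have hb : volume (Metric.ball x₀ (r + e (k + 1) / 8)) ≤ ENNReal.ofReal vol := by
      rw [← hvole]
      apply measure_mono
      apply Metric.ball_subset_ball
      have := heθ (k + 1)
      linarith
    calc _ ≤ ENNReal.ofReal (144 * e k / e (k + 1) ^ 2 * 2 ^ D) * ENNReal.ofReal vol := by
          gcongr
      _ = ENNReal.ofReal (144 * e k / e (k + 1) ^ 2 * 2 ^ D * vol) := by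
          rw [ENNReal.ofReal_mul (p := 144 * e k / e (k + 1) ^ 2 * 2 ^ D)]
          have := he0 k
          positivity
      _ ≤ ENNReal.ofReal (K * θ) := by
          apply ENNReal.ofReal_le_ofReal
          have h1 : 144 * e k / e (k + 1) ^ 2 * 2 ^ D * vol = K * e (k + 1) := by
            rw [hestep k hk, hK]
            have := (he0 (k + 1)).ne'
            field_simp
          rw [h1]
          have := heθ (k + 1)
          gcongr
  calc volume {x ∈ B | |F x| ≤ η} ≤ volume (⋃ k ∈ Finset.range N, S k) := measure_mono hcover
    _ ≤ ∑ k ∈ Finset.range N, volume (S k) := measure_biUnion_finset_le _ _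
    _ ≤ ∑ k ∈ Finset.range N, ENNReal.ofReal (K * θ) := Finset.sum_le_sum hSk
    _ = ENNReal.ofReal (N * (K * θ)) := by
        rw [Finset.sum_const, Finset.card_range, nsmul_eq_mul,
          ENNReal.ofReal_mul (p := (N : ℝ)) (by positivity), ENNReal.ofReal_natCast]
    _ ≤ _ := by
        apply ENNReal.ofReal_le_ofReal
        have h0 : 0 ≤ K * θ := by positivity
        calc (N:ℝ) * (K * θ) ≤ (N + 1) * K * θ := by nlinarith
          _ ≤ _ := le_mul_of_one_le_right (by positivity) hδi
end
end

section
/- Let U ⊆ ℝ² be a connected open set and let κ : U → ℝ be real analytic with ∂κ/∂x₁ and ∂κ/∂x₂ nowhere vanishing on U. Suppose that the function θ := ∂_{x₁}( (∂²κ/∂x₂²) / (∂κ/∂x₂) ) − ∂_{x₂}( (∂²κ/∂x₁²) / (∂κ/∂x₁) ) vanishes identically on U. Then every point of U has an open neighborhood V ⊆ U on which there exist real analytic functions u, v of one real variable and a real analytic function g, defined on a neighborhood of κ(V) with nowhere vanishing derivative, such that g(κ(x₁,x₂)) = u(x₁) + v(x₂) for all (x₁,x₂) ∈ V. -/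
open MeasureTheory Set
open scoped ENNReal

noncomputable section

/-- Directional (partial) derivative of `f : ℝ² → ℝ` in the `i`-th coordinate direction. -/
def pder (i : Fin 2) (f : EuclideanSpace ℝ (Fin 2) → ℝ) (x : EuclideanSpace ℝ (Fin 2)) : ℝ :=
  fderiv ℝ f x (EuclideanSpace.single i 1)

open Filter Topology

/-- Analytic functions of one real variable have local analytic primitives. -/
lemma exists_primitive_aux {f : ℝ → ℝ} {x₀ : ℝ} (hf : AnalyticAt ℝ f x₀) :
    ∃ u : ℝ → ℝ, AnalyticAt ℝ u x₀ ∧ ∀ᶠ x in 𝓝 x₀, HasDerivAt u (f x) x := by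
  obtain ⟨p, hp⟩ := hf
  let q : FormalMultilinearSeries ℝ ℝ ℝ :=
    FormalMultilinearSeries.ofScalars ℝ (fun n : ℕ => p.coeff (n - 1) / (n : ℝ))
  have hqc : ∀ n, q.coeff n = p.coeff (n - 1) / (n : ℝ) := by
    intro n
    simp [q]
  have hrad : p.radius ≤ q.radius := by
    refine ENNReal.le_of_forall_nnreal_lt fun r hr => ?_
    obtain ⟨C, hC, hb⟩ := p.norm_mul_pow_le_of_lt_radius hr
    refine q.le_radius_of_bound (C * r) fun n => ?_
    rw [FormalMultilinearSeries.norm_apply_eq_norm_coef, hqc]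
    rcases n with _ | n
    · simp
      positivity
    · have h1 := hb n
      rw [FormalMultilinearSeries.norm_apply_eq_norm_coef] at h1
      have h2 : ‖p.coeff n / ((n + 1 : ℕ) : ℝ)‖ ≤ ‖p.coeff n‖ := by
        rw [norm_div]
        apply div_le_self (norm_nonneg _)
        rw [Real.norm_natCast]
        exact_mod_cast Nat.succ_le_succ (Nat.zero_le n)
      calc ‖p.coeff (n + 1 - 1) / ((n + 1 : ℕ) : ℝ)‖ * (r : ℝ) ^ (n + 1)
          ≤ ‖p.coeff n‖ * (r : ℝ) ^ (n + 1) := by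
            gcongr
            simpa using h2
        _ = (‖p.coeff n‖ * (r : ℝ) ^ n) * r := by ring
        _ ≤ C * r := by gcongr
  have hpos : 0 < q.radius := lt_of_lt_of_le hp.radius_pos hrad
  have hQ := q.hasFPowerSeriesOnBall hpos
  have hsub : AnalyticAt ℝ (fun x : ℝ => x - x₀) x₀ := by fun_prop
  refine ⟨fun x => q.sum (x - x₀), ?_, ?_⟩
  · refine AnalyticAt.fun_comp (g := q.sum) ?_ hsub
    simpa using hQ.analyticAt
  · have e1 := hasFPowerSeriesAt_iff.1 hp
    have e2 := hasFPowerSeriesAt_iff.1 hQ.fderiv.hasFPowerSeriesAt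
    have e3 := hQ.analyticAt.eventually_analyticAt
    have ht : Tendsto (fun x : ℝ => x - x₀) (𝓝 x₀) (𝓝 0) := by
      have := hsub.continuousAt.tendsto
      simpa using this
    filter_upwards [ht.eventually e1, ht.eventually e2, ht.eventually e3] with x h1 h2 h3
    have h4 := h2.mapL (ContinuousLinearMap.apply ℝ ℝ (1 : ℝ))
    have h5 : f x = fderiv ℝ q.sum (x - x₀) 1 := by
      have h6 := h1.unique (a₂ := fderiv ℝ q.sum (x - x₀) 1) (by
        convert h4 using 1
        · ext n
          simp only [map_smul, ContinuousLinearMap.apply_apply,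
            FormalMultilinearSeries.derivSeries_coeff_one, hqc]
          have : ((n : ℝ) + 1) ≠ 0 := by positivity
          simp
          field_simp
          simp
        · simp)
      simpa using h6
    rw [h5, fderiv_apply_one_eq_deriv]
    have h7 := h3.differentiableAt.hasDerivAt
    simpa using h7.comp_sub_const x x₀

abbrev E2 := EuclideanSpace ℝ (Fin 2)

lemma hasDerivAt_slice0 {f : E2 → ℝ} {a b : ℝ} (hf : DifferentiableAt ℝ f !₂[a, b]) :
    HasDerivAt (fun s => f !₂[s, b]) (pder 0 f !₂[a, b]) a := by
  have h : HasDerivAt (fun s : ℝ => (!₂[s, b] : E2)) (EuclideanSpace.single 0 1) a := by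
    rw [hasDerivAt_iff_hasFDerivAt, ← hasFDerivWithinAt_univ, hasFDerivWithinAt_euclidean]
    intro i
    rw [hasFDerivWithinAt_univ]
    fin_cases i
    · simpa using! hasDerivAt_id a
    · simpa using! hasDerivAt_const a b
  exact hf.hasFDerivAt.comp_hasDerivAt a h

lemma hasDerivAt_slice1 {f : E2 → ℝ} {a b : ℝ} (hf : DifferentiableAt ℝ f !₂[a, b]) :
    HasDerivAt (fun s => f !₂[a, s]) (pder 1 f !₂[a, b]) b := by
  have h : HasDerivAt (fun s : ℝ => (!₂[a, s] : E2)) (EuclideanSpace.single 1 1) b := by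
    rw [hasDerivAt_iff_hasFDerivAt, ← hasFDerivWithinAt_univ, hasFDerivWithinAt_euclidean]
    intro i
    rw [hasFDerivWithinAt_univ]
    fin_cases i
    · simpa using! hasDerivAt_const b a
    · simpa using! hasDerivAt_id b
  exact hf.hasFDerivAt.comp_hasDerivAt b h

lemma vec_eta (x : E2) : !₂[x 0, x 1] = x := by
  ext i
  fin_cases i <;> simp

lemma analyticAt_pder {f : E2 → ℝ} {x : E2} (i : Fin 2) (hf : AnalyticAt ℝ f x) :
    AnalyticAt ℝ (pder i f) x :=
  ((ContinuousLinearMap.apply ℝ ℝ (EuclideanSpace.single i (1 : ℝ))).analyticAt _).fun_comp hf.fderiv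

lemma pder_congr {f g : E2 → ℝ} {x : E2} (i : Fin 2) (h : f =ᶠ[𝓝 x] g) :
    pder i f x = pder i g x := by
  unfold pder
  rw [h.fderiv_eq]

lemma pder_sub {f g : E2 → ℝ} {x : E2} (i : Fin 2) (hf : DifferentiableAt ℝ f x)
    (hg : DifferentiableAt ℝ g x) :
    pder i (fun y => f y - g y) x = pder i f x - pder i g x := by
  unfold pder
  rw [fderiv_fun_sub hf hg]
  rfl

lemma pder_log {f : E2 → ℝ} {x : E2} (i : Fin 2) (hf : DifferentiableAt ℝ f x) (h0 : f x ≠ 0) :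
    pder i (fun y => Real.log (f y)) x = pder i f x / f x := by
  unfold pder
  rw [(hf.hasFDerivAt.log h0).fderiv]
  simp [div_eq_inv_mul]

lemma analyticAt_log_comp {f : E2 → ℝ} {x : E2} (hf : AnalyticAt ℝ f x) (h0 : f x ≠ 0) :
    AnalyticAt ℝ (fun y => Real.log (f y)) x := by
  have : AnalyticAt ℝ Real.log (f x) :=
    (Real.contDiffAt_log.2 h0).analyticAt
  exact this.fun_comp hf

lemma pder_comm {f : E2 → ℝ} {x : E2} (hf : AnalyticAt ℝ f x) :
    pder 0 (pder 1 f) x = pder 1 (pder 0 f) x := by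
  have hs : IsSymmSndFDerivAt ℝ f x := hf.contDiffAt.isSymmSndFDerivAt_of_omega
  have key : ∀ i j : Fin 2, pder i (pder j f) x =
      fderiv ℝ (fderiv ℝ f) x (EuclideanSpace.single i 1) (EuclideanSpace.single j 1) := by
    intro i j
    have h := hf.fderiv.differentiableAt.hasFDerivAt
    have h2 := h.clm_apply (hasFDerivAt_const (EuclideanSpace.single j (1 : ℝ)) x)
    change fderiv ℝ (fun y => fderiv ℝ f y (EuclideanSpace.single j 1)) x _ = _
    rw [h2.fderiv]
    simp
  rw [key, key]
  exact hs _ _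

/-- A function with vanishing mixed derivative splits. -/
lemma split_aux {L : E2 → ℝ} {a₀ b₀ r : ℝ} (hr : 0 < r)
    (hL : ∀ a ∈ Metric.ball a₀ r, ∀ b ∈ Metric.ball b₀ r, AnalyticAt ℝ L !₂[a, b])
    (h0 : ∀ a ∈ Metric.ball a₀ r, ∀ b ∈ Metric.ball b₀ r, pder 0 (pder 1 L) !₂[a, b] = 0) :
    ∀ a ∈ Metric.ball a₀ r, ∀ b ∈ Metric.ball b₀ r,
      L !₂[a, b] - L !₂[a₀, b] = L !₂[a, b₀] - L !₂[a₀, b₀] := by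
  have ha₀ : a₀ ∈ Metric.ball a₀ r := Metric.mem_ball_self hr
  have hb₀ : b₀ ∈ Metric.ball b₀ r := Metric.mem_ball_self hr
  have h1 : ∀ a ∈ Metric.ball a₀ r, ∀ b ∈ Metric.ball b₀ r,
      pder 1 L !₂[a, b] = pder 1 L !₂[a₀, b] := by
    intro a ha b hb
    have hd : ∀ s ∈ Metric.ball a₀ r, HasDerivAt (fun s => pder 1 L !₂[s, b]) 0 s := by
      intro s hs
      have := hasDerivAt_slice0 (analyticAt_pder 1 (hL s hs b hb)).differentiableAt
      rwa [h0 s hs b hb] at this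
    exact Metric.isOpen_ball.is_const_of_deriv_eq_zero (convex_ball a₀ r).isPreconnected
      (fun s hs => (hd s hs).differentiableAt.differentiableWithinAt)
      (fun s hs => (hd s hs).deriv) ha ha₀
  intro a ha b hb
  have hd : ∀ s ∈ Metric.ball b₀ r, HasDerivAt (fun s => L !₂[a, s] - L !₂[a₀, s]) 0 s := by
    intro s hs
    have := (hasDerivAt_slice1 (hL a ha s hs).differentiableAt).fun_sub
      (hasDerivAt_slice1 (hL a₀ ha₀ s hs).differentiableAt)
    rwa [h1 a ha s hs, sub_self] at this
  exact Metric.isOpen_ball.is_const_of_deriv_eq_zero (convex_ball b₀ r).isPreconnected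
      (fun s hs => (hd s hs).differentiableAt.differentiableWithinAt)
      (fun s hs => (hd s hs).deriv) hb hb₀

/-- If `dF` is a nonvanishing multiple of `dκ`, then `F` is locally a function of `κ`. -/
lemma factor_aux {κ F : E2 → ℝ} {p : E2} {l : E2 → ℝ}
    (hκ : AnalyticAt ℝ κ p) (hp : pder 0 κ p ≠ 0)
    (hF : ∀ᶠ x in 𝓝 p, AnalyticAt ℝ F x)
    (hl : ∀ᶠ x in 𝓝 p, fderiv ℝ F x = l x • fderiv ℝ κ x ∧ l x ≠ 0) :
    ∃ (g : ℝ → ℝ) (W : Set ℝ), IsOpen W ∧ κ p ∈ W ∧ AnalyticOnNhd ℝ g W ∧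
      (∀ y ∈ W, deriv g y ≠ 0) ∧ ∀ᶠ x in 𝓝 p, κ x ∈ W ∧ g (κ x) = F x := by
  let Φ : E2 → ℝ × ℝ := fun x => (κ x, x 1)
  let π : E2 →L[ℝ] ℝ := EuclideanSpace.proj 1
  have hΦ : AnalyticAt ℝ Φ p := hκ.prod (π.analyticAt p)
  let A : E2 →L[ℝ] ℝ × ℝ := (fderiv ℝ κ p).prod π
  have hA : HasFDerivAt Φ A p := hκ.differentiableAt.hasFDerivAt.prodMk π.hasFDerivAt
  have hinj : Function.Injective A := by
    rw [injective_iff_map_eq_zero]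
    intro w hw
    have h1 : w 1 = 0 := congrArg Prod.snd hw
    have h2 : fderiv ℝ κ p w = 0 := congrArg Prod.fst hw
    have h3 : w = w 0 • EuclideanSpace.single 0 (1 : ℝ) := by
      ext i
      fin_cases i
      · simp
      · simpa using h1
    rw [h3, map_smul, smul_eq_mul] at h2
    have h4 : w 0 = 0 := (mul_eq_zero.1 h2).resolve_right hp
    rw [h3, h4, zero_smul]
  let i : E2 ≃L[ℝ] ℝ × ℝ :=
    (LinearEquiv.ofInjectiveOfFinrankEq A.toLinearMap hinj (by simp)).toContinuousLinearEquiv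
  have hi : (i : E2 →L[ℝ] ℝ × ℝ) = A := by
    ext <;> rfl
  have hst : HasStrictFDerivAt Φ (i : E2 →L[ℝ] ℝ × ℝ) p := by
    rw [hi, ← hA.fderiv]
    exact hΦ.hasStrictFDerivAt
  let Ψ : ℝ × ℝ → E2 := hst.localInverse Φ i p
  have hΨ : AnalyticAt ℝ Ψ (Φ p) :=
    (hst.toOpenPartialHomeomorph Φ).analyticAt_symm' (i := i)
      hst.mem_toOpenPartialHomeomorph_source hΦ (by rw [hi]; exact hA.fderiv)
  have hΨp : Ψ (Φ p) = p := hst.localInverse_apply_image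
  have hright : ∀ᶠ y in 𝓝 (Φ p), Φ (Ψ y) = y := hst.eventually_right_inverse
  have hleft : ∀ᶠ x in 𝓝 p, Ψ (Φ x) = x := hst.eventually_left_inverse
  have htend : Tendsto Ψ (𝓝 (Φ p)) (𝓝 p) := hst.localInverse_tendsto
  have hall := (hΨ.eventually_analyticAt.and hright).and
    ((htend.eventually hF).and ((htend.eventually hl).and
      (htend.eventually hκ.eventually_analyticAt)))
  obtain ⟨r, hr, hball⟩ := Metric.eventually_nhds_iff_ball.1 hall
  have hbox : ∀ t ∈ Metric.ball (κ p) r, ∀ s ∈ Metric.ball (p 1) r,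
      (t, s) ∈ Metric.ball (Φ p) r := by
    intro t ht s hs
    change (t, s) ∈ Metric.ball (κ p, p 1) r
    rw [← ball_prod_same]
    exact ⟨ht, hs⟩
  have hp1 : p 1 ∈ Metric.ball (p 1) r := Metric.mem_ball_self hr
  -- chain rule
  have chain : ∀ y ∈ Metric.ball (Φ p) r, ∀ w : ℝ × ℝ,
      fderiv ℝ (fun z => F (Ψ z)) y w = l (Ψ y) * w.1 := by
    intro y hy w
    obtain ⟨⟨h1, h2⟩, h3, ⟨h4, h5⟩, h6⟩ := hball y hy
    have c1 := h3.differentiableAt.hasFDerivAt.comp y h1.differentiableAt.hasFDerivAt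
    have c2 := h6.differentiableAt.hasFDerivAt.comp y h1.differentiableAt.hasFDerivAt
    have c3 : (κ ∘ Ψ) =ᶠ[𝓝 y] Prod.fst := by
      filter_upwards [Metric.isOpen_ball.mem_nhds hy] with z hz
      exact congrArg Prod.fst (hball z hz).1.2
    have c4 := c2.unique ((hasFDerivAt_fst (𝕜 := ℝ) (p := y)).congr_of_eventuallyEq c3)
    have c5 : fderiv ℝ (fun z => F (Ψ z)) y = _ := c1.fderiv
    rw [c5, h4]
    have c6 := congrArg (fun T : ℝ × ℝ →L[ℝ] ℝ => T w) c4
    simp only [ContinuousLinearMap.comp_apply, ContinuousLinearMap.coe_fst'] at c6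
    simp [c6]
  have hFΨ : ∀ y ∈ Metric.ball (Φ p) r, AnalyticAt ℝ (fun z => F (Ψ z)) y := fun y hy =>
    (hball y hy).2.1.fun_comp (hball y hy).1.1
  refine ⟨fun t => F (Ψ (t, p 1)), Metric.ball (κ p) r, Metric.isOpen_ball,
    Metric.mem_ball_self hr, ?_, ?_, ?_⟩
  · intro t ht
    exact (hFΨ (t, p 1) (hbox t ht _ hp1)).fun_comp (f := fun t : ℝ => (t, p 1)) (by fun_prop)
  · intro t ht
    have hy := hbox t ht _ hp1
    have d1 : HasDerivAt (fun t : ℝ => (t, p 1)) ((1 : ℝ), (0 : ℝ)) t :=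
      (hasDerivAt_id t).prodMk (hasDerivAt_const t (p 1))
    have d2 := (hFΨ _ hy).differentiableAt.hasFDerivAt.comp_hasDerivAt t d1
    have d3 : deriv (fun t => F (Ψ (t, p 1))) t = _ := d2.deriv
    rw [d3, chain _ hy]
    simpa using (hball _ hy).2.2.1.2
  · have hc : ∀ᶠ x in 𝓝 p, Φ x ∈ Metric.ball (Φ p) r :=
      hΦ.continuousAt.eventually (Metric.ball_mem_nhds _ hr)
    filter_upwards [hc, hleft] with x hx hlx
    have hx' : κ x ∈ Metric.ball (κ p) r ∧ x 1 ∈ Metric.ball (p 1) r := by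
      change (κ x, x 1) ∈ Metric.ball (κ p, p 1) r at hx
      rw [← ball_prod_same] at hx
      exact hx
    refine ⟨hx'.1, ?_⟩
    have hd : ∀ s ∈ Metric.ball (p 1) r, HasDerivAt (fun s => F (Ψ (κ x, s))) 0 s := by
      intro s hs
      have hy := hbox _ hx'.1 s hs
      have d1 : HasDerivAt (fun s : ℝ => (κ x, s)) ((0 : ℝ), (1 : ℝ)) s :=
        (hasDerivAt_const s (κ x)).prodMk (hasDerivAt_id s)
      have d2 := (hFΨ _ hy).differentiableAt.hasFDerivAt.comp_hasDerivAt s d1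
      rw [chain _ hy] at d2
      simpa using! d2
    have hconst := Metric.isOpen_ball.is_const_of_deriv_eq_zero
      (convex_ball (p 1) r).isPreconnected
      (fun s hs => (hd s hs).differentiableAt.differentiableWithinAt)
      (fun s hs => (hd s hs).deriv) hp1 hx'.2
    change F (Ψ (κ x, p 1)) = F x
    rw [hconst]
    exact congrArg F hlx

/-- Linearizability claim from the proof of Lemma 5.1: if the web curvature function
`θ = ∂₁(κ₂₂/κ₂) − ∂₂(κ₁₁/κ₁)` vanishes identically on `U`, then locally
`g ∘ κ (x₁,x₂) = u(x₁) + v(x₂)` for suitable analytic changes of variables. -/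
theorem vanishing_web_curvature_implies_linearizable
    (U : Set (EuclideanSpace ℝ (Fin 2))) (hUopen : IsOpen U) (hUconn : IsConnected U)
    (κ : EuclideanSpace ℝ (Fin 2) → ℝ) (hκ : AnalyticOnNhd ℝ κ U)
    (hκ₁ : ∀ x ∈ U, pder 0 κ x ≠ 0) (hκ₂ : ∀ x ∈ U, pder 1 κ x ≠ 0)
    (hθ : ∀ x ∈ U,
      pder 0 (fun y => pder 1 (pder 1 κ) y / pder 1 κ y) x -
        pder 1 (fun y => pder 0 (pder 0 κ) y / pder 0 κ y) x = 0) :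
    ∀ p ∈ U, ∃ V : Set (EuclideanSpace ℝ (Fin 2)),
      p ∈ V ∧ V ⊆ U ∧ IsOpen V ∧
      ∃ (u v g : ℝ → ℝ) (W : Set ℝ),
        AnalyticOnNhd ℝ u ((fun x : EuclideanSpace ℝ (Fin 2) => x 0) '' V) ∧
        AnalyticOnNhd ℝ v ((fun x : EuclideanSpace ℝ (Fin 2) => x 1) '' V) ∧
        IsOpen W ∧ κ '' V ⊆ W ∧ AnalyticOnNhd ℝ g W ∧
        (∀ y ∈ W, deriv g y ≠ 0) ∧
        ∀ x ∈ V, g (κ x) = u (x 0) + v (x 1) := by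
  intro p hp
  have hpU : ∀ᶠ x in 𝓝 p, x ∈ U := hUopen.mem_nhds hp
  have hA0 : ∀ x ∈ U, AnalyticAt ℝ (pder 0 κ) x := fun x hx => analyticAt_pder 0 (hκ x hx)
  have hA1 : ∀ x ∈ U, AnalyticAt ℝ (pder 1 κ) x := fun x hx => analyticAt_pder 1 (hκ x hx)
  -- the logarithm of the slope
  let L : E2 → ℝ := fun x => Real.log (pder 1 κ x) - Real.log (pder 0 κ x)
  have hLan : ∀ x ∈ U, AnalyticAt ℝ L x := fun x hx =>
    (analyticAt_log_comp (hA1 x hx) (hκ₂ x hx)).fun_sub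
      (analyticAt_log_comp (hA0 x hx) (hκ₁ x hx))
  have hL0 : ∀ x ∈ U, pder 0 (pder 1 L) x = 0 := by
    intro x hx
    have hxU : ∀ᶠ y in 𝓝 x, y ∈ U := hUopen.mem_nhds hx
    let M : E2 → ℝ := fun y => Real.log (pder 0 κ y)
    have hM : ∀ y ∈ U, AnalyticAt ℝ M y := fun y hy =>
      analyticAt_log_comp (hA0 y hy) (hκ₁ y hy)
    have e1 : pder 1 L =ᶠ[𝓝 x] fun y => pder 1 (pder 1 κ) y / pder 1 κ y - pder 1 M y := by
      filter_upwards [hxU] with y hy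
      rw [← pder_log 1 (hA1 y hy).differentiableAt (hκ₂ y hy)]
      exact pder_sub 1 (analyticAt_log_comp (hA1 y hy) (hκ₂ y hy)).differentiableAt
        (hM y hy).differentiableAt
    have e2 : pder 0 M =ᶠ[𝓝 x] fun y => pder 0 (pder 0 κ) y / pder 0 κ y := by
      filter_upwards [hxU] with y hy
      exact pder_log 0 (hA0 y hy).differentiableAt (hκ₁ y hy)
    rw [pder_congr 0 e1, pder_sub 0
      ((analyticAt_pder 1 (hA1 x hx)).fun_div (hA1 x hx) (hκ₂ x hx)).differentiableAt
      (analyticAt_pder 1 (hM x hx)).differentiableAt, pder_comm (hM x hx), pder_congr 1 e2]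
    exact hθ x hx
  -- the slope
  let R : E2 → ℝ := fun x => pder 1 κ x / pder 0 κ x
  have hR : ∀ x ∈ U, AnalyticAt ℝ R x := fun x hx => (hA1 x hx).fun_div (hA0 x hx) (hκ₁ x hx)
  have hR0 : ∀ x ∈ U, R x ≠ 0 := fun x hx => div_ne_zero (hκ₂ x hx) (hκ₁ x hx)
  have hLR : ∀ x ∈ U, L x = Real.log (R x) := fun x hx =>
    (Real.log_div (hκ₂ x hx) (hκ₁ x hx)).symm
  have hpe : !₂[p 0, p 1] = p := vec_eta p
  have hsl0 : AnalyticAt ℝ (fun s : ℝ => (!₂[s, p 1] : E2)) (p 0) := by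
    refine ContDiffAt.analyticAt ?_
    rw [contDiffAt_euclidean]
    intro i
    fin_cases i
    · exact contDiffAt_id
    · exact contDiffAt_const
  have hsl1 : AnalyticAt ℝ (fun s : ℝ => (!₂[p 0, s] : E2)) (p 1) := by
    refine ContDiffAt.analyticAt ?_
    rw [contDiffAt_euclidean]
    intro i
    fin_cases i
    · exact contDiffAt_const
    · exact contDiffAt_id
  have haan : AnalyticAt ℝ (fun s => R p / R !₂[s, p 1]) (p 0) := by
    refine analyticAt_const.fun_div (AnalyticAt.fun_comp (g := R) ?_ hsl0) ?_
    · rw [hpe]; exact hR p hp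
    · rw [hpe]; exact hR0 p hp
  have hban : AnalyticAt ℝ (fun s => R !₂[p 0, s]) (p 1) := by
    refine AnalyticAt.fun_comp (g := R) ?_ hsl1
    rw [hpe]; exact hR p hp
  obtain ⟨u, hu, hu'⟩ := exists_primitive_aux haan
  obtain ⟨v, hv, hv'⟩ := exists_primitive_aux hban
  -- choose a box
  have hpos : ∀ᶠ x in 𝓝 p, 0 < R x * R p := by
    have hc : ContinuousAt (fun x => R x * R p) p :=
      (hR p hp).continuousAt.mul continuousAt_const
    exact hc.eventually (lt_mem_nhds (mul_self_pos.2 (hR0 p hp)))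
  have hcont : Tendsto (fun z : ℝ × ℝ => (!₂[z.1, z.2] : E2)) (𝓝 (p 0, p 1)) (𝓝 p) := by
    have : Continuous (fun z : ℝ × ℝ => (!₂[z.1, z.2] : E2)) := by fun_prop
    have h := this.tendsto (p 0, p 1)
    simpa only [hpe] using h
  have hfst : Tendsto (Prod.fst : ℝ × ℝ → ℝ) (𝓝 (p 0, p 1)) (𝓝 (p 0)) := continuousAt_fst
  have hsnd : Tendsto (Prod.snd : ℝ × ℝ → ℝ) (𝓝 (p 0, p 1)) (𝓝 (p 1)) := continuousAt_snd
  have hall := (hcont.eventually (hpU.and hpos)).and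
    ((hfst.eventually (hu'.and hu.eventually_analyticAt)).and
      (hsnd.eventually (hv'.and hv.eventually_analyticAt)))
  obtain ⟨r, hr, hball⟩ := Metric.eventually_nhds_iff_ball.1 hall
  have hbox : ∀ a ∈ Metric.ball (p 0) r, ∀ b ∈ Metric.ball (p 1) r,
      (!₂[a, b] ∈ U ∧ 0 < R !₂[a, b] * R p) ∧
      (HasDerivAt u (R p / R !₂[a, p 1]) a ∧ AnalyticAt ℝ u a) ∧
      (HasDerivAt v (R !₂[p 0, b]) b ∧ AnalyticAt ℝ v b) := by
    intro a ha b hb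
    exact hball (a, b) (by rw [← ball_prod_same]; exact ⟨ha, hb⟩)
  have hp0 : p 0 ∈ Metric.ball (p 0) r := Metric.mem_ball_self hr
  have hp1 : p 1 ∈ Metric.ball (p 1) r := Metric.mem_ball_self hr
  have hsplit := split_aux (L := L) hr (fun a ha b hb => hLan _ (hbox a ha b hb).1.1)
    (fun a ha b hb => hL0 _ (hbox a ha b hb).1.1)
  have hRR : ∀ a ∈ Metric.ball (p 0) r, ∀ b ∈ Metric.ball (p 1) r,
      R !₂[a, b] * R p = R !₂[a, p 1] * R !₂[p 0, b] := by
    intro a ha b hb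
    have h := hsplit a ha b hb
    have q1 := (hbox a ha b hb).1
    have q2 := (hbox a ha _ hp1).1
    have q3 := (hbox _ hp0 b hb).1
    rw [hpe, hLR _ q1.1, hLR _ q2.1, hLR _ q3.1, hLR _ hp] at h
    have hpos2 : 0 < R !₂[a, p 1] * R !₂[p 0, b] := by
      have h3 := mul_pos q2.2 q3.2
      have h4 : 0 < R p * R p := mul_self_pos.2 (hR0 p hp)
      have h5 : R !₂[a, p 1] * R p * (R !₂[p 0, b] * R p) =
        (R !₂[a, p 1] * R !₂[p 0, b]) * (R p * R p) := by ring
      rw [h5] at h3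
      exact (pos_iff_pos_of_mul_pos h3).2 h4
    apply Real.log_injOn_pos q1.2 hpos2
    rw [Real.log_mul (hR0 _ q1.1) (hR0 _ hp), Real.log_mul (hR0 _ q2.1) (hR0 _ q3.1)]
    linarith
  let B : Set E2 := {x | x 0 ∈ Metric.ball (p 0) r ∧ x 1 ∈ Metric.ball (p 1) r}
  have hBopen : IsOpen B := by
    have c0 : Continuous fun x : E2 => x 0 := by fun_prop
    have c1 : Continuous fun x : E2 => x 1 := by fun_prop
    exact (Metric.isOpen_ball.preimage c0).inter (Metric.isOpen_ball.preimage c1)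
  have hpB : p ∈ B := ⟨hp0, hp1⟩
  have hBU : B ⊆ U := by
    intro x hx
    have := (hbox _ hx.1 _ hx.2).1.1
    rwa [vec_eta] at this
  let π₀ : E2 →L[ℝ] ℝ := EuclideanSpace.proj 0
  let π₁ : E2 →L[ℝ] ℝ := EuclideanSpace.proj 1
  let F : E2 → ℝ := fun x => u (x 0) + v (x 1)
  have hFan : ∀ x ∈ B, AnalyticAt ℝ F x := by
    intro x hx
    have hb := hbox _ hx.1 _ hx.2
    exact (hb.2.1.2.fun_comp (f := fun x : E2 => x 0) (π₀.analyticAt x)).fun_add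
      (hb.2.2.2.fun_comp (f := fun x : E2 => x 1) (π₁.analyticAt x))
  let l : E2 → ℝ := fun x => (R p / R !₂[x 0, p 1]) / pder 0 κ x
  have hl : ∀ x ∈ B, fderiv ℝ F x = l x • fderiv ℝ κ x ∧ l x ≠ 0 := by
    intro x hx
    have hb := hbox _ hx.1 _ hx.2
    have hxU := hBU hx
    have hq : R !₂[x 0, p 1] ≠ 0 := hR0 _ (hbox _ hx.1 _ hp1).1.1
    refine ⟨?_, div_ne_zero (div_ne_zero (hR0 p hp) hq) (hκ₁ x hxU)⟩
    have d0 := hb.2.1.1.comp_hasFDerivAt (f := fun x : E2 => x 0) x π₀.hasFDerivAt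
    have d1 := hb.2.2.1.comp_hasFDerivAt (f := fun x : E2 => x 1) x π₁.hasFDerivAt
    have d : fderiv ℝ F x = _ := (d0.add d1).fderiv
    have hrr := hRR _ hx.1 _ hx.2
    rw [vec_eta] at hrr
    have hk0 := hκ₁ x hxU
    have g0 : (R p / R !₂[x 0, p 1]) = l x * pder 0 κ x := (div_mul_cancel₀ _ hk0).symm
    have g1 : R !₂[p 0, x 1] = l x * pder 1 κ x := by
      have : R x * pder 0 κ x = pder 1 κ x := div_mul_cancel₀ _ hk0
      rw [← this]
      simp only [l]
      field_simp
      linarith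
    rw [d]
    ext w
    have hw : w = w 0 • EuclideanSpace.single 0 (1 : ℝ) + w 1 • EuclideanSpace.single 1 (1 : ℝ) := by
      ext i
      fin_cases i <;> simp
    have hkw : fderiv ℝ κ x w = w 0 * pder 0 κ x + w 1 * pder 1 κ x := by
      conv_lhs => rw [hw]
      rw [map_add, map_smul, map_smul]
      rfl
    change (R p / R !₂[x 0, p 1]) * w 0 + R !₂[p 0, x 1] * w 1 = l x * fderiv ℝ κ x w
    rw [hkw, g0, g1]
    ring
  obtain ⟨g, W, hW, hpW, hg, hg', hev⟩ := factor_aux (κ := κ) (F := F) (p := p) (l := l)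
    (hκ p hp) (hκ₁ p hp)
    (by filter_upwards [hBopen.mem_nhds hpB] with x hx using hFan x hx)
    (by filter_upwards [hBopen.mem_nhds hpB] with x hx using hl x hx)
  obtain ⟨V, hV, hVo, hpV⟩ := eventually_nhds_iff.1 (hev.and (hBopen.mem_nhds hpB))
  have hVB : V ⊆ B := fun x hx => (hV x hx).2
  refine ⟨V, hpV, hVB.trans hBU, hVo, u, v, g, W, ?_, ?_, hW, ?_, hg, hg', ?_⟩
  · rintro _ ⟨x, hx, rfl⟩
    exact (hbox _ (hVB hx).1 _ (hVB hx).2).2.1.2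
  · rintro _ ⟨x, hx, rfl⟩
    exact (hbox _ (hVB hx).1 _ (hVB hx).2).2.2.2
  · rintro _ ⟨x, hx, rfl⟩
    exact (hV x hx).1.1
  · intro x hx
    exact (hV x hx).1.2
end
end

section
/- Let φ_j : B̃ → ℝ (j = 1,2,3) be real analytic, and suppose that for every i ≠ j the gradients ∇φ_i(x) and ∇φ_j(x) are linearly independent at each point x ∈ B. Assume that for every nonempty connected open set U ⊆ B̃ and every triple (f₁,f₂,f₃) of real analytic functions f_j : φ_j(U) → ℝ satisfying f₁(φ₁(x)) + f₂(φ₂(x)) + f₃(φ₃(x)) = 0 for all x ∈ U, each composition f_j ∘ φ_j is constant on U. Then there exist a positive integer M and C ∈ (0,∞) such that for every x̄ ∈ B and every triple f of C^M functions defined near (φ₁(x̄),φ₂(x̄),φ₃(x̄)) with f_j(φ_j(x̄)) = 0 for each j: Σ_{j=1}^3 Σ_{k=1}^M |f_j^{(k)}(φ_j(x̄))| ≤ C · Σ_{1 ≤ |α| ≤ M} |∂^α G_f(x̄)|, where G_f(x) = f₁(φ₁(x)) + f₂(φ₂(x)) + f₃(φ₃(x)). -/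
open MeasureTheory Set
open scoped ENNReal

noncomputable section

namespace FT

open Filter Topology Asymptotics

abbrev E2 := EuclideanSpace ℝ (Fin 2)

/-- The universal coefficients in the Faa di Bruno formula. -/
def W (φ : E2 → ℝ) {k : ℕ} (c : OrderedFinpartition k) (x : E2) :
    ContinuousMultilinearMap ℝ (fun _ : Fin k => E2) ℝ :=
  c.compAlongOrderedFinpartition (ContinuousMultilinearMap.mkPiAlgebra ℝ (Fin c.length) ℝ)
    (fun i => iteratedFDeriv ℝ (c.partSize i) φ x)

def T (φ : Fin 3 → E2 → ℝ) (k : ℕ) (x : E2) (a : Fin 3 → ℕ → ℝ) :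
    ContinuousMultilinearMap ℝ (fun _ : Fin k => E2) ℝ :=
  ∑ j, ∑ c : OrderedFinpartition k, a j c.length • W (φ j) c x

lemma T_congr (φ : Fin 3 → E2 → ℝ) {k : ℕ} (hk : 1 ≤ k) (x : E2) {a b : Fin 3 → ℕ → ℝ}
    (h : ∀ j, ∀ n ∈ Finset.Icc 1 k, a j n = b j n) : T φ k x a = T φ k x b := by
  unfold T
  refine Finset.sum_congr rfl fun j _ => Finset.sum_congr rfl fun c _ => ?_
  rw [h j c.length (Finset.mem_Icc.2 ⟨c.length_pos hk, c.length_le⟩)]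

lemma T_smul (φ : Fin 3 → E2 → ℝ) (k : ℕ) (x : E2) (s : ℝ) (a : Fin 3 → ℕ → ℝ) :
    T φ k x (s • a) = s • T φ k x a := by
  simp [T, Finset.smul_sum, mul_smul]

lemma iter_comp {φ : E2 → ℝ} {x : E2} (hφ : AnalyticAt ℝ φ x) {f : ℝ → ℝ} {M : ℕ}
    (hf : ContDiffAt ℝ M f (φ x)) {k : ℕ} (hk : k ≤ M) :
    iteratedFDeriv ℝ k (fun y => f (φ y)) x =
      ∑ c : OrderedFinpartition k, iteratedDeriv c.length f (φ x) • W φ c x := by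
  have h := iteratedFDeriv_comp (i := k) hf (hφ.contDiffAt (n := M)) (by exact_mod_cast hk)
  change iteratedFDeriv ℝ k (f ∘ φ) x = _
  rw [h]
  unfold FormalMultilinearSeries.taylorComp
  refine Finset.sum_congr rfl fun c _ => ?_
  ext v
  simp [W, FormalMultilinearSeries.compAlongOrderedFinpartition, ftaylorSeries,
    iteratedFDeriv_apply_eq_iteratedDeriv_mul_prod, mul_comm]

lemma iter_eq {φ : Fin 3 → E2 → ℝ} {x : E2} (hφ : ∀ j, AnalyticAt ℝ (φ j) x)
    {f : Fin 3 → ℝ → ℝ} {M : ℕ}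
    (hf : ∀ j, ContDiffAt ℝ M (f j) (φ j x)) {k : ℕ} (hk : k ≤ M) :
    iteratedFDeriv ℝ k (fun y => ∑ j, f j (φ j y)) x =
      T φ k x (fun j n => iteratedDeriv n (f j) (φ j x)) := by
  have h1 : ∀ j, ContDiffAt ℝ k (fun y => f j (φ j y)) x := fun j =>
    ((hf j).comp x (hφ j).contDiffAt).of_le (by exact_mod_cast hk)
  have := iteratedFDeriv_fun_sum_apply (𝕜 := ℝ) (n := k) (u := Finset.univ)
    (f := fun j y => f j (φ j y)) (x := x) (fun j _ => h1 j)
  rw [this]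
  unfold T
  exact Finset.sum_congr rfl fun j _ => iter_comp (hφ j) (hf j) hk

lemma continuousOn_T {φ : Fin 3 → E2 → ℝ} {B : Set E2} (hφ : ∀ j, AnalyticOnNhd ℝ (φ j) B)
    (k : ℕ) :
    ContinuousOn (fun p : E2 × (Fin 3 → ℕ → ℝ) => T φ k p.1 p.2) (B ×ˢ univ) := by
  unfold T
  refine continuousOn_finsetSum _ fun j _ => continuousOn_finsetSum _ fun c _ => ?_
  refine ContinuousOn.smul (f := fun p : E2 × (Fin 3 → ℕ → ℝ) => p.2 j c.length)
    (by fun_prop) ?_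
  have : ContinuousOn (fun x => W (φ j) c x) B := by
    have h2 : ContinuousOn (fun x => fun i : Fin c.length =>
        iteratedFDeriv ℝ (c.partSize i) (φ j) x) B :=
      continuousOn_pi.2 fun i => ((hφ j).iteratedFDeriv _).continuousOn
    exact (c.compAlongOrderedFinpartitionL ℝ E2 ℝ ℝ
      (ContinuousMultilinearMap.mkPiAlgebra ℝ (Fin c.length) ℝ)).cont.comp_continuousOn h2
  exact this.comp continuousOn_fst (fun p hp => hp.1)

/-- Taylor polynomial with prescribed derivatives. -/
def P (M : ℕ) (t : ℝ) (a : ℕ → ℝ) (s : ℝ) : ℝ :=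
  ∑ m ∈ Finset.Icc 1 M, a m / (m.factorial : ℝ) * (s - t) ^ m

lemma P_analytic (M : ℕ) (t : ℝ) (a : ℕ → ℝ) (s : ℝ) : AnalyticAt ℝ (P M t a) s := by
  unfold P
  fun_prop

lemma P_self (M : ℕ) (t : ℝ) (a : ℕ → ℝ) : P M t a t = 0 := by
  unfold P
  refine Finset.sum_eq_zero fun m hm => ?_
  have := (Finset.mem_Icc.1 hm).1
  simp [show m ≠ 0 by omega]

lemma P_iter (M : ℕ) (t : ℝ) (a : ℕ → ℝ) {n : ℕ} (hn : n ∈ Finset.Icc 1 M) :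
    iteratedDeriv n (P M t a) t = a n := by
  unfold P
  rw [iteratedDeriv_fun_sum (fun i _ => by fun_prop)]
  have : ∀ m, iteratedDeriv n (fun s : ℝ => a m / (m.factorial : ℝ) * (s - t) ^ m) t =
      if m = n then a n else 0 := by
    intro m
    rw [iteratedDeriv_const_mul_field, iteratedDeriv_comp_sub_const n (fun s : ℝ => s ^ m) t]
    simp only [iteratedDeriv_pow, sub_self]
    rcases lt_trichotomy m n with h | h | h
    · simp [Nat.descFactorial_of_lt h, h.ne]
    · subst h
      simp [Nat.descFactorial_self]
      field_simp
    · simp [h.ne', show m - n ≠ 0 by omega]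
  simp only [this]
  rw [Finset.sum_ite_eq' , if_pos hn]

lemma exists_primitive {g : ℝ → ℝ} {t : ℝ} (hg : AnalyticAt ℝ g t) :
    ∃ f : ℝ → ℝ, AnalyticAt ℝ f t ∧ f t = 0 ∧ ∀ᶠ s in 𝓝 t, HasDerivAt f (g s) s := by
  obtain ⟨p, R, hp⟩ := hg
  obtain ⟨r, hr0, hrR⟩ := ENNReal.lt_iff_exists_nnreal_btwn.1 hp.r_pos
  obtain ⟨C, hC0, hC⟩ := p.norm_mul_pow_le_of_lt_radius (hrR.trans_le hp.r_le)
  set q : FormalMultilinearSeries ℝ ℝ ℝ :=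
    FormalMultilinearSeries.ofScalars ℝ (fun n : ℕ => p.coeff (n - 1) / (n : ℝ)) with hq
  have hqr : (r : ℝ≥0∞) ≤ q.radius := by
    refine q.le_radius_of_bound (C * r) fun n => ?_
    rw [hq, FormalMultilinearSeries.ofScalars_norm]
    rcases n with _ | n
    · simp; positivity
    · have h1 := hC n
      have h2 : ‖p.coeff n‖ = ‖p n‖ := by
        rw [← FormalMultilinearSeries.norm_apply_eq_norm_coef]
      rw [← h2] at h1
      have h3 : ‖p.coeff (n + 1 - 1) / ((n + 1 : ℕ) : ℝ)‖ ≤ ‖p.coeff n‖ := by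
        rw [norm_div, Nat.add_sub_cancel]
        refine div_le_self (norm_nonneg _) ?_
        simp
        exact_mod_cast (by rw [abs_of_nonneg (by positivity)]; linarith [(Nat.cast_nonneg n : (0:ℝ) ≤ n)] : (1:ℝ) ≤ |(n:ℝ) + 1|)
      calc _ ≤ ‖p.coeff n‖ * (r : ℝ) ^ (n + 1) := by gcongr
        _ = (‖p.coeff n‖ * (r : ℝ) ^ n) * r := by ring
        _ ≤ C * r := by gcongr
  have hqpos : 0 < q.radius := hr0.trans_le hqr
  have hF := (q.hasFPowerSeriesOnBall hqpos).comp_sub t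
  simp only [zero_add] at hF
  refine ⟨fun s => q.sum (s - t), hF.analyticAt, ?_, ?_⟩
  · have := (q.hasFPowerSeriesOnBall hqpos).coeff_zero (fun _ => 0)
    simp only [sub_self]
    rw [← this]
    simp [hq]
  · have hF' := hF.fderiv
    have hd := hF.analyticAt.eventually_analyticAt
    filter_upwards [hF'.eventually_hasSum_sub, hp.eventually_hasSum_sub, hd] with s h1 h2 h3
    have h4 := h3.differentiableAt.hasDerivAt
    have h5 := h1.mapL (ContinuousLinearMap.apply ℝ ℝ (1 : ℝ))
    have h6 : g s = deriv (fun s => q.sum (s - t)) s := by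
      refine HasSum.unique h2 ?_
      convert! h5 using 2 with n
      rw [FormalMultilinearSeries.apply_eq_pow_smul_coeff,
        FormalMultilinearSeries.apply_eq_pow_smul_coeff]
      simp only [ContinuousLinearMap.apply_apply, smul_apply]
      rw [FormalMultilinearSeries.derivSeries_coeff_one]
      simp [hq, FormalMultilinearSeries.coeff_ofScalars]
      field_simp
      exact Or.inl trivial
    rw [h6]; exact h4

lemma taylor_bigO {F : Type*} [NormedAddCommGroup F] [NormedSpace ℝ F] [CompleteSpace F]
    {X : Type*} [NormedAddCommGroup X] [NormedSpace ℝ X]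
    {G : X → F} {x : X} (hG : AnalyticAt ℝ G x) {M : ℕ}
    (h : ∀ k < M, iteratedFDeriv ℝ k G x = 0) :
    G =O[𝓝 x] fun y => ‖y - x‖ ^ M := by
  obtain ⟨p, R, hp⟩ := hG
  have h1 := hp.hasFPowerSeriesAt.isBigO_sub_partialSum_pow M
  have h2 : ∀ y, p.partialSum M y = 0 := by
    intro y
    refine Finset.sum_eq_zero fun k hk => ?_
    have h3 := hp.factorial_smul y k
    rw [h k (Finset.mem_range.1 hk)] at h3
    have h4 : (k.factorial : ℝ) • p k (fun _ => y) = 0 := by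
      rw [Nat.cast_smul_eq_nsmul, h3]; simp
    exact (smul_eq_zero.1 h4).resolve_left (by positivity)
  simp only [h2, sub_zero] at h1
  have h4 : Tendsto (fun y => y - x) (𝓝 x) (𝓝 0) := by
    have : Continuous fun y : X => y - x := by fun_prop
    simpa using this.tendsto x
  simpa [Function.comp_def] using h1.comp_tendsto h4

lemma taylor_bigO_fderiv {F : Type*} [NormedAddCommGroup F] [NormedSpace ℝ F] [CompleteSpace F]
    {X : Type*} [NormedAddCommGroup X] [NormedSpace ℝ X]
    {G : X → F} {x : X} (hG : AnalyticAt ℝ G x) {M : ℕ}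
    (h : ∀ k ∈ Finset.Icc 1 M, iteratedFDeriv ℝ k G x = 0) :
    fderiv ℝ G =O[𝓝 x] fun y => ‖y - x‖ ^ M := by
  refine taylor_bigO hG.fderiv fun k hk => ?_
  rw [← norm_eq_zero, norm_iteratedFDeriv_fderiv, h (k + 1) (by simp; omega), norm_zero]

lemma series_zero {F : Type*} [NormedAddCommGroup F] [NormedSpace ℝ F]
    {X : Type*} [NormedAddCommGroup X] [NormedSpace ℝ X]
    {G : X → F} {x : X} {p : FormalMultilinearSeries ℝ X F} (hG : HasFPowerSeriesAt G p x)
    {M : ℕ} (h : G =O[𝓝 x] fun y => ‖y - x‖ ^ (M + 1)) :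
    ∀ n ≤ M, ∀ y, p n (fun _ => y) = 0 := by
  have h0 : (fun y => G (x + y)) =O[𝓝 0] fun y => ‖y‖ ^ (M + 1) := by
    have h4 : Tendsto (fun y => x + y) (𝓝 (0 : X)) (𝓝 x) := by
      have : Continuous fun y : X => x + y := by fun_prop
      simpa using this.tendsto 0
    simpa [Function.comp_def] using h.comp_tendsto h4
  intro n
  induction n using Nat.strong_induction_on with
  | _ n ih =>
    intro hn
    refine IsBigO.continuousMultilinearMap_apply_eq_zero ?_
    have h1 := hG.isBigO_sub_partialSum_pow (n + 1)
    have h2 : (fun y => G (x + y)) =O[𝓝 0] fun y => ‖y‖ ^ (n + 1) := by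
      refine h0.trans ?_
      refine IsBigO.of_bound 1 ?_
      filter_upwards [Metric.ball_mem_nhds (0 : X) one_pos] with y hy
      simp only [norm_pow, norm_norm, one_mul]
      refine pow_le_pow_of_le_one (norm_nonneg _) ?_ (by omega)
      simpa using (mem_ball_zero_iff.1 hy).le
    have h3 := h2.sub h1
    refine h3.congr_left fun y => ?_
    have : p.partialSum (n + 1) y = p n (fun _ => y) := by
      unfold FormalMultilinearSeries.partialSum
      rw [Finset.sum_range_succ, Finset.sum_eq_zero, zero_add]
      intro k hk
      have hk := Finset.mem_range.1 hk
      exact ih k hk (by omega) y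
    simp [this]

lemma eventually_zero {F : Type*} [NormedAddCommGroup F] [NormedSpace ℝ F]
    {X : Type*} [NormedAddCommGroup X] [NormedSpace ℝ X]
    {G : X → F} {x : X} (hG : AnalyticAt ℝ G x)
    (h : ∀ M : ℕ, 1 ≤ M → G =O[𝓝 x] fun y => ‖y - x‖ ^ (M + 1)) :
    ∀ᶠ y in 𝓝 x, G y = 0 := by
  obtain ⟨p, hp⟩ := hG
  filter_upwards [hp.eventually_hasSum_sub] with y hy
  refine hy.unique ?_
  have : ∀ n, p n (fun _ => y - x) = 0 := fun n =>
    series_zero hp (h (n + 1) (by omega)) n (by omega) _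
  simp only [this]
  exact hasSum_zero

lemma iter_zero {f : ℝ → ℝ} {t : ℝ} (hf : AnalyticAt ℝ f t) {M : ℕ}
    (h : f =O[𝓝 t] fun s => ‖s - t‖ ^ (M + 1)) {n : ℕ} (hn : n ≤ M) :
    iteratedDeriv n f t = 0 := by
  obtain ⟨p, R, hp⟩ := hf
  have h3 := hp.factorial_smul (1 : ℝ) n
  rw [series_zero hp.hasFPowerSeriesAt h n hn] at h3
  rw [iteratedDeriv_eq_iteratedFDeriv, ← h3, smul_zero]

lemma mvt_bigO {h h' : ℝ → ℝ} {t : ℝ} {M : ℕ} (hd : ∀ᶠ s in 𝓝 t, HasDerivAt h (h' s) s)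
    (hO : h' =O[𝓝 t] fun s => ‖s - t‖ ^ M) (h0 : h t = 0) :
    h =O[𝓝 t] fun s => ‖s - t‖ ^ (M + 1) := by
  obtain ⟨C, hC0, hC⟩ := hO.exists_nonneg
  replace hC := hC.bound
  obtain ⟨δ, hδ, hb⟩ := Metric.eventually_nhds_iff_ball.1 (hd.and hC)
  refine IsBigO.of_bound C ?_
  filter_upwards [Metric.ball_mem_nhds t hδ] with s hs
  have hsub : Metric.closedBall t ‖s - t‖ ⊆ Metric.ball t δ := by
    refine Metric.closedBall_subset_ball ?_
    simpa [dist_eq_norm] using hs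
  have := (convex_closedBall t ‖s - t‖).norm_image_sub_le_of_norm_hasDerivWithin_le
    (f := h) (f' := h') (C := C * ‖s - t‖ ^ M) (x := t) (y := s)
    (fun u hu => (hb u (hsub hu)).1.hasDerivWithinAt) (fun u hu => ?_)
    (by simp) (by simp [dist_eq_norm])
  · rw [h0, sub_zero] at this
    refine this.trans (le_of_eq ?_)
    simp [pow_succ, mul_assoc]
  · refine ((hb u (hsub hu)).2).trans ?_
    have : ‖u - t‖ ≤ ‖s - t‖ := by simpa [dist_eq_norm] using hu
    rw [norm_pow, norm_norm]
    gcongr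

/-- planar determinant of two linear forms -/
def D (l m : E2 →L[ℝ] ℝ) : ℝ :=
  l (EuclideanSpace.single 0 1) * m (EuclideanSpace.single 1 1) -
    l (EuclideanSpace.single 1 1) * m (EuclideanSpace.single 0 1)

lemma e2_ext {l : E2 →L[ℝ] ℝ} (h0 : l (EuclideanSpace.single 0 1) = 0)
    (h1 : l (EuclideanSpace.single 1 1) = 0) : l = 0 := by
  have : (l : E2 →ₗ[ℝ] ℝ) = 0 := by
    refine (EuclideanSpace.basisFun (Fin 2) ℝ).toBasis.ext fun i => ?_
    fin_cases i <;> simp [h0, h1]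
  ext v
  exact LinearMap.congr_fun this v

lemma e2_decomp (l : E2 →L[ℝ] ℝ) (v : E2) :
    l v = v 0 * l (EuclideanSpace.single 0 1) + v 1 * l (EuclideanSpace.single 1 1) := by
  have : v = v 0 • EuclideanSpace.single 0 1 + v 1 • EuclideanSpace.single 1 1 := by
    ext i; fin_cases i <;> simp
  conv_lhs => rw [this]
  simp

lemma D_ne {l m : E2 →L[ℝ] ℝ} (h : LinearIndependent ℝ ![l, m]) : D l m ≠ 0 := by
  intro hD
  unfold D at hD
  rw [LinearIndependent.pair_iff] at h
  have h1 := h (m (EuclideanSpace.single 1 1)) (-l (EuclideanSpace.single 1 1))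
    (e2_ext (by simp; linarith) (by simp; ring))
  have h2 := h (m (EuclideanSpace.single 0 1)) (-l (EuclideanSpace.single 0 1))
    (e2_ext (by simp; ring) (by simp; linarith))
  have h3 := h 1 0 (e2_ext (by simpa using h2.2) (by simpa using h1.2))
  simp at h3

lemma exists_curve {φ ψ : E2 → ℝ} {x : E2} (hφ : AnalyticAt ℝ φ x) (hψ : AnalyticAt ℝ ψ x)
    (hD : D (fderiv ℝ φ x) (fderiv ℝ ψ x) ≠ 0) :
    ∃ γ : ℝ → E2, AnalyticAt ℝ γ (φ x) ∧ γ (φ x) = x ∧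
      ∀ᶠ s in 𝓝 (φ x), φ (γ s) = s ∧ ψ (γ s) = ψ x := by
  set L : E2 →L[ℝ] ℝ × ℝ := (fderiv ℝ φ x).prod (fderiv ℝ ψ x) with hL
  have hinj : Function.Injective (L : E2 →ₗ[ℝ] ℝ × ℝ) := by
    refine (injective_iff_map_eq_zero _).2 fun v hv => ?_
    have h1 : fderiv ℝ φ x v = 0 := congrArg Prod.fst hv
    have h2 : fderiv ℝ ψ x v = 0 := congrArg Prod.snd hv
    rw [e2_decomp] at h1 h2
    unfold D at hD
    set a := fderiv ℝ φ x (EuclideanSpace.single 0 1)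
    set b := fderiv ℝ φ x (EuclideanSpace.single 1 1)
    set c := fderiv ℝ ψ x (EuclideanSpace.single 0 1)
    set d := fderiv ℝ ψ x (EuclideanSpace.single 1 1)
    have h3 : v 0 = 0 := by
      have : v 0 * (a * d - b * c) = 0 := by linear_combination d * h1 - b * h2
      exact (mul_eq_zero.1 this).resolve_right hD
    have h4 : v 1 = 0 := by
      have : v 1 * (a * d - b * c) = 0 := by linear_combination a * h2 - c * h1
      exact (mul_eq_zero.1 this).resolve_right hD
    ext i; fin_cases i <;> simp [h3, h4]
  set e : E2 ≃L[ℝ] ℝ × ℝ :=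
    (LinearEquiv.ofInjectiveOfFinrankEq (L : E2 →ₗ[ℝ] ℝ × ℝ) hinj (by simp)).toContinuousLinearEquiv
    with he
  have heL : (e : E2 →L[ℝ] ℝ × ℝ) = L := by
    ext v <;> rfl
  have hA : AnalyticAt ℝ (fun y => (φ y, ψ y)) x := hφ.prod hψ
  have hder : HasFDerivAt (fun y => (φ y, ψ y)) (e : E2 →L[ℝ] ℝ × ℝ) x := by
    rw [heL]
    exact hφ.differentiableAt.hasFDerivAt.prodMk hψ.differentiableAt.hasFDerivAt
  have hc : ContDiffAt ℝ (⊤ : WithTop ℕ∞) (fun y => (φ y, ψ y)) x := hA.contDiffAt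
  have hn : (⊤ : WithTop ℕ∞) ≠ 0 := by simp
  set g := hc.localInverse hder hn with hg
  have hg1 : ContDiffAt ℝ (⊤ : WithTop ℕ∞) g (φ x, ψ x) := hc.to_localInverse hder hn
  have hga : AnalyticAt ℝ g (φ x, ψ x) := by
    exact hg1.analyticAt
  have hgx : g (φ x, ψ x) = x := hc.localInverse_apply_image hder hn
  have hr : ∀ᶠ z in 𝓝 (φ x, ψ x), (φ (g z), ψ (g z)) = z := 
    (hc.hasStrictFDerivAt' hder hn).eventually_right_inverse
  have hline : AnalyticAt ℝ (fun s : ℝ => (s, ψ x)) (φ x) := analyticAt_id.prod analyticAt_const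
  refine ⟨fun s => g (s, ψ x), ?_, hgx, ?_⟩
  · exact AnalyticAt.fun_comp (g := g) (f := fun s : ℝ => (s, ψ x)) hga hline
  · have := hline.continuousAt.tendsto.eventually hr
    filter_upwards [this] with s hs
    exact ⟨congrArg Prod.fst hs, congrArg Prod.snd hs⟩

lemma comp_bigO {X Y F : Type*} [NormedAddCommGroup X] [NormedSpace ℝ X]
    [NormedAddCommGroup Y] [NormedSpace ℝ Y] [NormedAddCommGroup F] {h : X → Y} {x : X} {z : Y}
    {H : Y → F} {n : ℕ} (hh : AnalyticAt ℝ h x) (hz : h x = z)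
    (hH : H =O[𝓝 z] fun y => ‖y - z‖ ^ n) :
    (fun s => H (h s)) =O[𝓝 x] fun s => ‖s - x‖ ^ n := by
  subst hz
  have h1 := hH.comp_tendsto hh.continuousAt.tendsto
  refine h1.trans ?_
  exact (hh.differentiableAt.isBigO_sub.norm_norm).pow n

lemma d_analytic {φ ψ : E2 → ℝ} {x : E2} (hφ : AnalyticAt ℝ φ x) (hψ : AnalyticAt ℝ ψ x) :
    AnalyticAt ℝ (fun y => D (fderiv ℝ φ y) (fderiv ℝ ψ y)) x := by
  unfold D
  have h1 : ∀ v, AnalyticAt ℝ (fun y => fderiv ℝ φ y v) x := fun v =>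
    ((ContinuousLinearMap.apply ℝ ℝ v).analyticAt _).fun_comp hφ.fderiv
  have h2 : ∀ v, AnalyticAt ℝ (fun y => fderiv ℝ ψ y v) x := fun v =>
    ((ContinuousLinearMap.apply ℝ ℝ v).analyticAt _).fun_comp hψ.fderiv
  exact ((h1 _).mul (h2 _)).sub ((h1 _).mul (h2 _))

lemma local_structure {φ : Fin 3 → E2 → ℝ} {x : E2} (hφ : ∀ j, AnalyticAt ℝ (φ j) x)
    (hD : ∀ i j, i ≠ j → D (fderiv ℝ (φ i) x) (fderiv ℝ (φ j) x) ≠ 0) :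
    ∃ f : Fin 3 → ℝ → ℝ, (∀ j, AnalyticAt ℝ (f j) (φ j x)) ∧
      (∃ γ : ℝ → E2, AnalyticAt ℝ γ (φ 2 x) ∧ γ (φ 2 x) = x ∧ ∀ᶠ s in 𝓝 (φ 2 x), φ 2 (γ s) = s) ∧
      deriv (f 2) (φ 2 x) ≠ 0 ∧
      ∀ (M : ℕ) (Q : Fin 3 → ℝ → ℝ), (∀ j, AnalyticAt ℝ (Q j) (φ j x)) →
        (∀ j, Q j (φ j x) = 0) →
        ((fun y => ∑ j, Q j (φ j y)) =O[𝓝 x] fun y => ‖y - x‖ ^ (M + 1)) →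
        ((fderiv ℝ fun y => ∑ j, Q j (φ j y)) =O[𝓝 x] fun y => ‖y - x‖ ^ M) →
        ∀ j, (fun s => Q j s - deriv (Q 1) (φ 1 x) * f j s) =O[𝓝 (φ j x)]
          fun s => ‖s - φ j x‖ ^ (M + 1) := by
  obtain ⟨γ, hγ, hγx, hγe⟩ := exists_curve (hφ 2) (hφ 1) (hD 2 1 (by decide))
  obtain ⟨γa, hγa, hγax, hγae⟩ := exists_curve (hφ 0) (hφ 1) (hD 0 1 (by decide))
  obtain ⟨γb, hγb, hγbx, hγbe⟩ := exists_curve (hφ 1) (hφ 0) (hD 1 0 (by decide))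
  set d1 : E2 → ℝ := fun y => D (fderiv ℝ (φ 0) y) (fderiv ℝ (φ 1) y) with hd1
  set d2 : E2 → ℝ := fun y => D (fderiv ℝ (φ 0) y) (fderiv ℝ (φ 2) y) with hd2
  have ad1 : AnalyticAt ℝ d1 x := d_analytic (hφ 0) (hφ 1)
  have ad2 : AnalyticAt ℝ d2 x := d_analytic (hφ 0) (hφ 2)
  have d1x : d1 x ≠ 0 := hD 0 1 (by decide)
  have d2x : d2 x ≠ 0 := hD 0 2 (by decide)
  have ag0 : AnalyticAt ℝ (fun y => -(d1 y / d2 y)) x := (ad1.div ad2 d2x).neg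
  have ag : AnalyticAt ℝ (fun s => -(d1 (γ s) / d2 (γ s))) (φ 2 x) :=
    AnalyticAt.fun_comp (g := fun y => -(d1 y / d2 y)) (by rwa [hγx]) hγ
  obtain ⟨f2, af2, f2x, hf2⟩ := exists_primitive ag
  have acomp : ∀ (δ : ℝ → E2) (t : ℝ), AnalyticAt ℝ δ t → δ t = x →
      AnalyticAt ℝ (fun s => -f2 (φ 2 (δ s))) t := by
    intro δ t hδ ht
    have h1 : AnalyticAt ℝ (fun y => f2 (φ 2 y)) x := af2.fun_comp (hφ 2)
    exact (AnalyticAt.fun_comp (g := fun y => f2 (φ 2 y)) (by rwa [ht]) hδ).neg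
  refine ⟨![fun s => -f2 (φ 2 (γa s)), fun s => -f2 (φ 2 (γb s)), f2], ?_, 
    ⟨γ, hγ, hγx, hγe.mono fun s hs => hs.1⟩, ?_, ?_⟩
  · intro j
    fin_cases j
    · exact acomp γa _ hγa hγax
    · exact acomp γb _ hγb hγbx
    · exact af2
  · have := hf2.self_of_nhds.deriv
    change deriv f2 _ ≠ 0
    rw [this, hγx]
    exact neg_ne_zero.2 (div_ne_zero d1x d2x)
  · intro M Q aQ Q0 hG hG'
    set G : E2 → ℝ := fun y => ∑ j, Q j (φ j y) with hGdef
    set c := deriv (Q 1) (φ 1 x) with hc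
    have key2 : (fun s => Q 2 s - c * f2 s) =O[𝓝 (φ 2 x)] fun s => ‖s - φ 2 x‖ ^ (M + 1) := by
      refine mvt_bigO (h' := fun s => deriv (Q 2) s - c * (-(d1 (γ s) / d2 (γ s)))) ?_ ?_ ?_
      · filter_upwards [hf2, (aQ 2).eventually_analyticAt] with s h1 h2
        exact h2.differentiableAt.hasDerivAt.sub (h1.const_mul c)
      · have hid : ∀ᶠ y in 𝓝 x, D (fderiv ℝ (φ 0) y) (fderiv ℝ G y) =
            deriv (Q 1) (φ 1 y) * d1 y + deriv (Q 2) (φ 2 y) * d2 y := by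
          have hev : ∀ᶠ y in 𝓝 x, ∀ j, HasFDerivAt (fun y => Q j (φ j y))
              (deriv (Q j) (φ j y) • fderiv ℝ (φ j) y) y := by
            refine eventually_all.2 fun j => ?_
            filter_upwards [(hφ j).eventually_analyticAt,
              (hφ j).continuousAt.tendsto.eventually (aQ j).eventually_analyticAt] with y h1 h2
            exact h2.differentiableAt.hasDerivAt.comp_hasFDerivAt y
              h1.differentiableAt.hasFDerivAt
          filter_upwards [hev] with y hy
          have : HasFDerivAt G (∑ j, deriv (Q j) (φ j y) • fderiv ℝ (φ j) y) y :=
            HasFDerivAt.fun_sum fun j _ => hy j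
          rw [this.fderiv, hd1, hd2]
          simp only [D, Fin.sum_univ_three]
          simp
          ring
        have hO : (fun y => D (fderiv ℝ (φ 0) y) (fderiv ℝ G y) / d2 y) =O[𝓝 x]
            fun y => ‖y - x‖ ^ M := by
          have hv : ∀ v, (fun y => fderiv ℝ G y v) =O[𝓝 x] fun y => ‖y - x‖ ^ M := by
            intro v
            refine IsBigO.trans ?_ hG'
            exact (ContinuousLinearMap.apply ℝ ℝ v).isBigO_comp _ _
          have hu : ∀ v, (fun y => fderiv ℝ (φ 0) y v / d2 y) =O[𝓝 x] fun _ => (1 : ℝ) := by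
            intro v
            have h1 : AnalyticAt ℝ (fun y => fderiv ℝ (φ 0) y v) x :=
              ((ContinuousLinearMap.apply ℝ ℝ v).analyticAt _).fun_comp (hφ 0).fderiv
            exact (h1.div ad2 d2x).continuousAt.tendsto.isBigO_one ℝ
          have := ((hu (EuclideanSpace.single 0 1)).mul (hv (EuclideanSpace.single 1 1))).sub
            ((hu (EuclideanSpace.single 1 1)).mul (hv (EuclideanSpace.single 0 1)))
          simp only [one_mul] at this
          refine this.congr_left fun y => ?_
          simp only [D]
          ring
        refine (comp_bigO hγ hγx hO).congr' ?_ EventuallyEq.rfl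
        have hγt : Tendsto γ (𝓝 (φ 2 x)) (𝓝 x) := by
          have := hγ.continuousAt.tendsto
          rwa [hγx] at this
        filter_upwards [hγe, hγt.eventually hid,
          hγt.eventually (ad2.continuousAt.eventually_ne d2x)] with s h1 h2 h3
        rw [h2, h1.1, h1.2]
        field_simp
        ring
      · simp [f2x, Q0]
    have keyg : ∀ (δ : ℝ → E2) (t : ℝ) (q : ℝ → ℝ), AnalyticAt ℝ δ t → δ t = x →
        (∀ᶠ s in 𝓝 t, G (δ s) = q s + Q 2 (φ 2 (δ s))) →
        (fun s => q s - c * (-f2 (φ 2 (δ s)))) =O[𝓝 t] fun s => ‖s - t‖ ^ (M + 1) := by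
      intro δ t q hδ ht he
      have h1 := comp_bigO hδ ht hG
      have h2 := comp_bigO hδ ht (comp_bigO (hφ 2) rfl key2)
      refine (h1.sub h2).congr' ?_ EventuallyEq.rfl
      filter_upwards [he] with s hs
      rw [hs]
      ring
    intro j
    fin_cases j
    · refine keyg γa _ (Q 0) hγa hγax ?_
      filter_upwards [hγae] with s hs
      simp [hGdef, Fin.sum_univ_three, hs.1, hs.2, Q0]
    · refine keyg γb _ (Q 1) hγb hγbx ?_
      filter_upwards [hγbe] with s hs
      simp [hGdef, Fin.sum_univ_three, hs.1, hs.2, Q0]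
    · exact key2

lemma ker_Q {φ : Fin 3 → E2 → ℝ} {x : E2} (hφ : ∀ j, AnalyticAt ℝ (φ j) x) {M : ℕ}
    {a : Fin 3 → ℕ → ℝ} (ha : ∀ k ∈ Finset.Icc 1 M, T φ k x a = 0) :
    ((fun y => ∑ j, P M (φ j x) (a j) (φ j y)) =O[𝓝 x] fun y => ‖y - x‖ ^ (M + 1)) ∧
    ((fderiv ℝ fun y => ∑ j, P M (φ j x) (a j) (φ j y)) =O[𝓝 x] fun y => ‖y - x‖ ^ M) := by
  have hA : AnalyticAt ℝ (fun y => ∑ j, P M (φ j x) (a j) (φ j y)) x :=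
    Finset.analyticAt_fun_sum _ fun j _ => (P_analytic M _ _ _).fun_comp (hφ j)
  have h1 : ∀ k ∈ Finset.Icc 1 M,
      iteratedFDeriv ℝ k (fun y => ∑ j, P M (φ j x) (a j) (φ j y)) x = 0 := by
    intro k hk
    have hk' := Finset.mem_Icc.1 hk
    rw [iter_eq hφ (f := fun j => P M (φ j x) (a j)) (M := M)
      (fun j => (P_analytic M _ _ _).contDiffAt) hk'.2, ← ha k hk]
    refine T_congr φ hk'.1 x fun j n hn => ?_
    have hn' := Finset.mem_Icc.1 hn
    exact P_iter M _ _ (Finset.mem_Icc.2 ⟨hn'.1, hn'.2.trans hk'.2⟩)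
  refine ⟨taylor_bigO hA fun k hk => ?_, taylor_bigO_fderiv hA h1⟩
  rcases Nat.eq_zero_or_pos k with rfl | hk0
  · ext v
    simp [P_self]
  · exact h1 k (Finset.mem_Icc.2 ⟨hk0, by omega⟩)

lemma P_deriv {M : ℕ} (hM : 1 ≤ M) (t : ℝ) (a : ℕ → ℝ) : deriv (P M t a) t = a 1 := by
  rw [← iteratedDeriv_one]
  exact P_iter M t a (Finset.mem_Icc.2 ⟨le_rfl, hM⟩)

lemma ker_zero {φ : Fin 3 → E2 → ℝ} {x : E2} (hφ : ∀ j, AnalyticAt ℝ (φ j) x)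
    (hD : ∀ i j, i ≠ j → D (fderiv ℝ (φ i) x) (fderiv ℝ (φ j) x) ≠ 0) {M : ℕ} (hM : 1 ≤ M)
    {a : Fin 3 → ℕ → ℝ} (ha : ∀ k ∈ Finset.Icc 1 M, T φ k x a = 0) (h1 : a 1 1 = 0) :
    ∀ j, ∀ n ∈ Finset.Icc 1 M, a j n = 0 := by
  obtain ⟨f, -, -, -, hf⟩ := local_structure hφ hD
  obtain ⟨hO, hO'⟩ := ker_Q hφ ha
  have := hf M (fun j => P M (φ j x) (a j)) (fun j => P_analytic _ _ _ _)
    (fun j => P_self _ _ _) hO hO'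
  simp only [P_deriv hM, h1, zero_mul, sub_zero] at this
  intro j n hn
  rw [← P_iter M (φ j x) (a j) hn]
  exact iter_zero (P_analytic _ _ _ _) (this j) (Finset.mem_Icc.1 hn).2

lemma ker_contra {φ : Fin 3 → E2 → ℝ} {x : E2} {Bt : Set E2} (hB : IsOpen Bt) (hx : x ∈ Bt)
    (hφ : ∀ j, AnalyticOnNhd ℝ (φ j) Bt)
    (hD : ∀ i j, i ≠ j → D (fderiv ℝ (φ i) x) (fderiv ℝ (φ j) x) ≠ 0)
    (hMain : ∀ U : Set E2, U ⊆ Bt → IsOpen U → U.Nonempty →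
      IsConnected U → ∀ f : Fin 3 → ℝ → ℝ,
      (∀ j, AnalyticOnNhd ℝ (f j) (φ j '' U)) →
      (∀ x ∈ U, ∑ j, f j (φ j x) = 0) →
      ∀ j, ∀ x ∈ U, ∀ x' ∈ U, f j (φ j x) = f j (φ j x'))
    (h : ∀ M : ℕ, 1 ≤ M → ∃ a : Fin 3 → ℕ → ℝ,
      (∀ k ∈ Finset.Icc 1 M, T φ k x a = 0) ∧ a 1 1 ≠ 0) : False := by
  have hφx : ∀ j, AnalyticAt ℝ (φ j) x := fun j => hφ j x hx
  obtain ⟨f, af, ⟨γ, hγ, hγx, hγe⟩, hf2, hf⟩ := local_structure hφx hD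
  have hA : AnalyticAt ℝ (fun y => ∑ j, f j (φ j y)) x :=
    Finset.analyticAt_fun_sum _ fun j _ => (af j).fun_comp (hφx j)
  have hz : ∀ᶠ y in 𝓝 x, ∑ j, f j (φ j y) = 0 := by
    refine eventually_zero hA fun M hM => ?_
    obtain ⟨a, ha, ha1⟩ := h M hM
    obtain ⟨hO, hO'⟩ := ker_Q hφx ha
    have h1 := hf M (fun j => P M (φ j x) (a j)) (fun j => P_analytic _ _ _ _)
      (fun j => P_self _ _ _) hO hO'
    simp only [P_deriv hM] at h1
    have h2 : (fun y => ∑ j, (P M (φ j x) (a j) (φ j y) - a 1 1 * f j (φ j y)))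
        =O[𝓝 x] fun y => ‖y - x‖ ^ (M + 1) :=
      IsBigO.fun_sum fun j _ => comp_bigO (hφx j) rfl (h1 j)
    have h3 := (hO.sub h2).const_mul_left (a 1 1)⁻¹
    refine h3.congr_left fun y => ?_
    rw [Finset.sum_sub_distrib, ← Finset.mul_sum]
    field_simp
    ring
  have hev : ∀ᶠ y in 𝓝 x, (∑ j, f j (φ j y) = 0) ∧ y ∈ Bt ∧ ∀ j, AnalyticAt ℝ (f j) (φ j y) := by
    refine hz.and (Eventually.and (hB.eventually_mem hx) (eventually_all.2 fun j => ?_))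
    exact (hφx j).continuousAt.tendsto.eventually (af j).eventually_analyticAt
  obtain ⟨δ, hδ, hb⟩ := Metric.eventually_nhds_iff_ball.1 hev
  have hne : (Metric.ball x δ).Nonempty := ⟨x, Metric.mem_ball_self hδ⟩
  have hcon := hMain (Metric.ball x δ) (fun y hy => (hb y hy).2.1) Metric.isOpen_ball hne
    ⟨hne, (convex_ball x δ).isPreconnected⟩ f
    (by
      rintro j _ ⟨y, hy, rfl⟩
      exact (hb y hy).2.2 j)
    (fun y hy => (hb y hy).1) 2
  have hγt : Tendsto γ (𝓝 (φ 2 x)) (𝓝 x) := by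
    have := hγ.continuousAt.tendsto
    rwa [hγx] at this
  have hconst : f 2 =ᶠ[𝓝 (φ 2 x)] fun _ => f 2 (φ 2 x) := by
    filter_upwards [hγe, hγt.eventually (Metric.ball_mem_nhds x hδ)] with s h1 h2
    have := hcon (γ s) h2 x (Metric.mem_ball_self hδ)
    rwa [h1] at this
  apply hf2
  rw [hconst.deriv_eq]
  simp

def S (M : ℕ) : Set (Fin 3 → ℕ → ℝ) :=
  {a | (∀ j n, n ∉ Finset.Icc 1 M → a j n = 0) ∧ ∑ j, ∑ n ∈ Finset.Icc 1 M, |a j n| = 1}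

lemma S_compact (M : ℕ) : IsCompact (S M) := by
  have hK : IsCompact (Set.pi univ fun _ : Fin 3 => Set.pi univ fun _ : ℕ => Icc (-1 : ℝ) 1) :=
    isCompact_univ_pi fun _ => isCompact_univ_pi fun _ => isCompact_Icc
  refine hK.of_isClosed_subset ?_ ?_
  · have hS : S M = (⋂ j, ⋂ n, ⋂ (_ : n ∉ Finset.Icc 1 M), {a : Fin 3 → ℕ → ℝ | a j n = 0}) ∩
        {a : Fin 3 → ℕ → ℝ | ∑ j, ∑ n ∈ Finset.Icc 1 M, |a j n| = 1} := by
      ext a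
      simp only [S, mem_inter_iff, mem_iInter]
      exact Iff.rfl
    rw [hS]
    refine IsClosed.inter ?_ ?_
    · refine isClosed_iInter fun j => isClosed_iInter fun n => isClosed_iInter fun _ => ?_
      exact isClosed_eq (by fun_prop) continuous_const
    · exact isClosed_eq (by fun_prop) continuous_const
  · rintro a ⟨h1, h2⟩ j - n -
    change a j n ∈ Icc (-1 : ℝ) 1
    rw [mem_Icc, ← abs_le]
    by_cases hn : n ∈ Finset.Icc 1 M
    · calc |a j n| ≤ ∑ n ∈ Finset.Icc 1 M, |a j n| :=
            Finset.single_le_sum (f := fun n => |a j n|) (fun _ _ => abs_nonneg _) hn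
        _ ≤ ∑ j, ∑ n ∈ Finset.Icc 1 M, |a j n| :=
            Finset.single_le_sum (f := fun j => ∑ n ∈ Finset.Icc 1 M, |a j n|)
              (fun _ _ => Finset.sum_nonneg fun _ _ => abs_nonneg _) (Finset.mem_univ j)
        _ = 1 := h2
    · simp [h1 j n hn]

def N (φ : Fin 3 → E2 → ℝ) (M : ℕ) (x : E2) (a : Fin 3 → ℕ → ℝ) : ℝ :=
  ∑ k ∈ Finset.Icc 1 M, ‖T φ k x a‖

lemma N_eq_zero {φ : Fin 3 → E2 → ℝ} {M : ℕ} {x : E2} {a : Fin 3 → ℕ → ℝ} :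
    N φ M x a = 0 ↔ ∀ k ∈ Finset.Icc 1 M, T φ k x a = 0 := by
  unfold N
  rw [Finset.sum_eq_zero_iff_of_nonneg (fun _ _ => norm_nonneg _)]
  simp

lemma normalize (φ : Fin 3 → E2 → ℝ) (M : ℕ) (x : E2) (a : Fin 3 → ℕ → ℝ)
    (hs : 0 < ∑ j, ∑ n ∈ Finset.Icc 1 M, |a j n|) :
    ∃ b ∈ S M, N φ M x b = (∑ j, ∑ n ∈ Finset.Icc 1 M, |a j n|)⁻¹ * N φ M x a := by
  set s := ∑ j, ∑ n ∈ Finset.Icc 1 M, |a j n| with hsdef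
  refine ⟨fun j n => if n ∈ Finset.Icc 1 M then s⁻¹ * a j n else 0, ⟨?_, ?_⟩, ?_⟩
  · intro j n hn
    simp only [if_neg hn]
  · have : ∀ j, ∑ n ∈ Finset.Icc 1 M, |if n ∈ Finset.Icc 1 M then s⁻¹ * a j n else 0| =
        s⁻¹ * ∑ n ∈ Finset.Icc 1 M, |a j n| := by
      intro j
      rw [Finset.mul_sum]
      refine Finset.sum_congr rfl fun n hn => ?_
      rw [if_pos hn, abs_mul, abs_of_pos (inv_pos.2 hs)]
    simp only [this]
    rw [← Finset.mul_sum, ← hsdef, inv_mul_cancel₀ hs.ne']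
  · unfold N
    rw [Finset.mul_sum]
    refine Finset.sum_congr rfl fun k hk => ?_
    have hk' := Finset.mem_Icc.1 hk
    have h1 : T φ k x (fun j n => if n ∈ Finset.Icc 1 M then s⁻¹ * a j n else 0) =
        T φ k x (s⁻¹ • a) := by
      refine T_congr φ hk'.1 x fun j n hn => ?_
      have hn' := Finset.mem_Icc.1 hn
      rw [if_pos (Finset.mem_Icc.2 ⟨hn'.1, hn'.2.trans hk'.2⟩)]
      simp
    rw [h1, T_smul, norm_smul, Real.norm_of_nonneg (inv_pos.2 hs).le]

lemma continuousOn_N {φ : Fin 3 → E2 → ℝ} {B : Set E2} (hφ : ∀ j, AnalyticOnNhd ℝ (φ j) B)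
    (M : ℕ) :
    ContinuousOn (fun p : E2 × (Fin 3 → ℕ → ℝ) => N φ M p.1 p.2) (B ×ˢ univ) :=
  continuousOn_finsetSum _ fun k _ => (continuousOn_T hφ k).norm

lemma sum_pos_of_ne {M : ℕ} {a : Fin 3 → ℕ → ℝ} {j : Fin 3} {n : ℕ} (hn : n ∈ Finset.Icc 1 M)
    (h : a j n ≠ 0) : 0 < ∑ j, ∑ n ∈ Finset.Icc 1 M, |a j n| := by
  refine Finset.sum_pos' (fun _ _ => Finset.sum_nonneg fun _ _ => abs_nonneg _)
    ⟨j, Finset.mem_univ j, ?_⟩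
  exact Finset.sum_pos' (fun _ _ => abs_nonneg _) ⟨n, hn, abs_pos.2 h⟩

theorem jet_inequality {φ : Fin 3 → E2 → ℝ} {B Bt : Set E2} (hBt : IsOpen Bt) (hBc : IsCompact B)
    (hBB : B ⊆ Bt) (hφ : ∀ j, AnalyticOnNhd ℝ (φ j) Bt)
    (hD : ∀ x ∈ B, ∀ i j, i ≠ j → D (fderiv ℝ (φ i) x) (fderiv ℝ (φ j) x) ≠ 0)
    (hMain : ∀ U : Set E2, U ⊆ Bt → IsOpen U → U.Nonempty →
      IsConnected U → ∀ f : Fin 3 → ℝ → ℝ,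
      (∀ j, AnalyticOnNhd ℝ (f j) (φ j '' U)) →
      (∀ x ∈ U, ∑ j, f j (φ j x) = 0) →
      ∀ j, ∀ x ∈ U, ∀ x' ∈ U, f j (φ j x) = f j (φ j x')) :
    ∃ (M : ℕ) (C : ℝ), 0 < M ∧ 0 < C ∧ ∀ x ∈ B, ∀ a : Fin 3 → ℕ → ℝ,
      ∑ j, ∑ n ∈ Finset.Icc 1 M, |a j n| ≤ C * N φ M x a := by
  have hφB : ∀ j, AnalyticOnNhd ℝ (φ j) B := fun j => (hφ j).mono hBB
  have hcN : ∀ M, ContinuousOn (fun p : E2 × (Fin 3 → ℕ → ℝ) => N φ M p.1 p.2) (B ×ˢ S M) :=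
    fun M => (continuousOn_N hφB M).mono (prod_mono le_rfl (subset_univ _))
  have hnz : ∀ M, 1 ≤ M → ∀ x ∈ B, ∀ a ∈ S M, N φ M x a = 0 → a 1 1 ≠ 0 := by
    intro M hM x hx a ha h0 h1
    have := ker_zero (fun j => hφB j x hx) (hD x hx) hM (N_eq_zero.1 h0) h1
    have h2 := ha.2
    rw [Finset.sum_eq_zero] at h2
    · exact zero_ne_one h2
    · intro j _
      refine Finset.sum_eq_zero fun n hn => ?_
      rw [this j n hn, abs_zero]
  set Z : ℕ → Set E2 := fun m =>
    Prod.fst '' ((B ×ˢ S (m + 1)) ∩ (fun p : E2 × (Fin 3 → ℕ → ℝ) => N φ (m + 1) p.1 p.2) ⁻¹' {0})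
    with hZ
  have hZc : ∀ m, IsCompact (Z m) := by
    intro m
    have hK := hBc.prod (S_compact (m + 1))
    refine IsCompact.image ?_ continuous_fst
    exact hK.of_isClosed_subset
      ((hcN (m + 1)).preimage_isClosed_of_isClosed hK.isClosed isClosed_singleton)
      inter_subset_left
  have hex : ∃ m, Z m = ∅ := by
    by_contra hcon
    push Not at hcon
    have hdec : ∀ m, Z (m + 1) ⊆ Z m := by
      rintro m _ ⟨⟨x, a⟩, ⟨⟨hx, ha⟩, h0⟩, rfl⟩
      have h11 := hnz (m + 2) (by omega) x hx a ha h0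
      obtain ⟨b, hb, hbN⟩ := normalize φ (m + 1) x a
        (sum_pos_of_ne (j := 1) (n := 1) (by simp) h11)
      refine ⟨⟨x, b⟩, ⟨⟨hx, hb⟩, ?_⟩, rfl⟩
      have h3 : N φ (m + 1) x a = 0 := by
        rw [N_eq_zero]
        intro k hk
        have hk' := Finset.mem_Icc.1 hk
        exact N_eq_zero.1 h0 k (Finset.mem_Icc.2 ⟨hk'.1, by omega⟩)
      simp [hbN, h3]
    obtain ⟨x, hx⟩ := IsCompact.nonempty_iInter_of_sequence_nonempty_isCompact_isClosed Z hdec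
      hcon (hZc 0) (fun m => (hZc m).isClosed)
    rw [mem_iInter] at hx
    have hxB : x ∈ B := by
      obtain ⟨p, hp, rfl⟩ := hx 0
      exact hp.1.1
    refine ker_contra hBt (hBB hxB) hφ (hD x hxB) hMain fun M hM => ?_
    obtain ⟨m, rfl⟩ : ∃ m, M = m + 1 := ⟨M - 1, by omega⟩
    obtain ⟨⟨y, a⟩, ⟨⟨hy, ha⟩, h0⟩, rfl⟩ := hx m
    exact ⟨a, N_eq_zero.1 h0, hnz (m + 1) hM y hy a ha h0⟩
  obtain ⟨m, hm⟩ := hex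
  have hpos : ∀ p ∈ B ×ˢ S (m + 1), 0 < N φ (m + 1) p.1 p.2 := by
    intro p hp
    refine lt_of_le_of_ne (Finset.sum_nonneg fun _ _ => norm_nonneg _) fun h0 => ?_
    have : p.1 ∈ Z m := ⟨p, ⟨hp, h0.symm⟩, rfl⟩
    rw [hm] at this
    exact this
  obtain ⟨c, hc, hcle⟩ := (hBc.prod (S_compact (m + 1))).exists_forall_le' (hcN (m + 1)) hpos
  refine ⟨m + 1, c⁻¹, by omega, inv_pos.2 hc, fun x hx a => ?_⟩
  rcases (Finset.sum_nonneg fun j _ => Finset.sum_nonneg fun n _ => abs_nonneg (a j n) :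
    0 ≤ ∑ j, ∑ n ∈ Finset.Icc 1 (m + 1), |a j n|).eq_or_lt with h0 | h0
  · rw [← h0]
    exact mul_nonneg (inv_pos.2 hc).le (Finset.sum_nonneg fun _ _ => norm_nonneg _)
  · obtain ⟨b, hb, hbN⟩ := normalize φ (m + 1) x a h0
    have := hcle (x, b) ⟨hx, hb⟩
    simp only [hbN] at this
    rw [inv_mul_eq_div, le_div_iff₀ hc]
    rw [inv_mul_eq_div, le_div_iff₀ h0] at this
    linarith

end FT

/-- Lemma 11.3: quantitative finite-type inequality for sums `f₁∘φ₁ + f₂∘φ₂ + f₃∘φ₃`,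
under the hypothesis that any exact analytic solution has all `fⱼ ∘ φⱼ` constant. -/
theorem finite_type_inequality_constant_version
    (x₀ : EuclideanSpace ℝ (Fin 2)) (r : ℝ) (hr : 0 < r)
    (Bt : Set (EuclideanSpace ℝ (Fin 2))) (hBtOpen : IsOpen Bt) (hBtConn : IsConnected Bt)
    (hBBt : Metric.closedBall x₀ r ⊆ Bt)
    (φ : Fin 3 → EuclideanSpace ℝ (Fin 2) → ℝ)
    (hφ : ∀ j, AnalyticOnNhd ℝ (φ j) Bt)
    (hInd : ∀ i j : Fin 3, i ≠ j → ∀ x ∈ Metric.closedBall x₀ r,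
      LinearIndependent ℝ ![fderiv ℝ (φ i) x, fderiv ℝ (φ j) x])
    (hMain : ∀ U : Set (EuclideanSpace ℝ (Fin 2)), U ⊆ Bt → IsOpen U → U.Nonempty →
      IsConnected U → ∀ f : Fin 3 → ℝ → ℝ,
      (∀ j, AnalyticOnNhd ℝ (f j) (φ j '' U)) →
      (∀ x ∈ U, ∑ j, f j (φ j x) = 0) →
      ∀ j, ∀ x ∈ U, ∀ x' ∈ U, f j (φ j x) = f j (φ j x')) :
    ∃ (M : ℕ) (C : ℝ), 0 < M ∧ 0 < C ∧
      ∀ xb ∈ Metric.closedBall x₀ r, ∀ f : Fin 3 → ℝ → ℝ,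
        (∀ j, ContDiffAt ℝ M (f j) (φ j xb)) →
        (∀ j, f j (φ j xb) = 0) →
        (∑ j, ∑ k ∈ Finset.Icc 1 M, |iteratedDeriv k (f j) (φ j xb)|) ≤
          C * ∑ k ∈ Finset.Icc 1 M,
            ‖iteratedFDeriv ℝ k (fun x => ∑ j, f j (φ j x)) xb‖ := by
  obtain ⟨M, C, hM, hC, h⟩ := FT.jet_inequality hBtOpen
    (isCompact_closedBall x₀ r) hBBt hφ
    (fun x hx i j hij => FT.D_ne (hInd i j hij x hx)) hMain
  refine ⟨M, C, hM, hC, fun xb hxb f hf _ => ?_⟩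
  refine (h xb hxb (fun j n => iteratedDeriv n (f j) (φ j xb))).trans (le_of_eq ?_)
  congr 1
  refine Finset.sum_congr rfl fun k hk => ?_
  rw [FT.iter_eq (fun j => hφ j xb (hBBt hxb)) hf (Finset.mem_Icc.1 hk).2]
end
end
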